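/- Let Γ be a virtually polycyclic group equipped with a proper left invariant metric. Then asdim Γ = h(Γ), where h(Γ) is the Hirsch length of Γ. -/

import Mathlib

open scoped TensorProduct

/-- A family `𝒰` of subsets of a metric space is `d`-disjoint if any two points lying in
distinct members of `𝒰` are at distance greater than `d`. -/
def DDisjoint {X : Type*} [MetricSpace X] (d : ℝ) (𝒰 : Set (Set X)) : Prop :=
  ∀ U ∈ 𝒰, ∀ V ∈ 𝒰, U ≠ V → ∀ x ∈ U, ∀ y ∈ V, d < dist x y

/-- A family `𝒰` of subsets of a metric space is `R`-bounded if every member has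
diameter at most `R`. -/
def RBounded {X : Type*} [MetricSpace X] (R : ℝ) (𝒰 : Set (Set X)) : Prop :=
  ∀ U ∈ 𝒰, ∀ x ∈ U, ∀ y ∈ U, dist x y ≤ R

/-- `AsdimLE X n` : the metric space `X` has asymptotic dimension at most `n`, i.e. for
every `d > 0` there are `R > 0` and `n+1` families of subsets of `X`, each `R`-bounded and
`d`-disjoint, whose union covers `X`. -/
def AsdimLE (X : Type*) [MetricSpace X] (n : ℕ) : Prop :=
  ∀ d : ℝ, 0 < d → ∃ R : ℝ, 0 < R ∧ ∃ 𝒰 : Fin (n + 1) → Set (Set X),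
    (∀ i, RBounded R (𝒰 i)) ∧ (∀ i, DDisjoint d (𝒰 i)) ∧ (⋃ i, ⋃₀ 𝒰 i) = Set.univ

/-- The asymptotic dimension of a metric space, as an element of `ℕ∞`: the least `n` such
that `AsdimLE X n` holds, or `⊤` if there is no such `n`. -/
noncomputable def asdim (X : Type*) [MetricSpace X] : ℕ∞ :=
  sInf {m : ℕ∞ | ∃ n : ℕ, m = (n : ℕ∞) ∧ AsdimLE X n}


/-- A group is polycyclic if it admits a subnormal series `⊥ = s 0 ⊴ s 1 ⊴ ⋯ ⊴ s n = ⊤`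
with cyclic quotients (each quotient `s (i+1) / s i` is generated by the image of a single
element). -/
def IsPolycyclic (G : Type*) [Group G] : Prop :=
  ∃ (n : ℕ) (s : Fin (n + 1) → Subgroup G),
    s 0 = ⊥ ∧ s (Fin.last n) = ⊤ ∧
    ∀ i : Fin n, s i.castSucc ≤ s i.succ ∧
      ((s i.castSucc).subgroupOf (s i.succ)).Normal ∧
      ∃ g ∈ s i.succ, ∀ x ∈ s i.succ, ∃ k : ℤ, x * (g ^ k)⁻¹ ∈ s i.castSucc

open scoped Classical in
/-- The dimension of a `ℚ`-vector space as an element of `ℕ∞` (`⊤` if infinite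
dimensional). -/
noncomputable def qdim (V : Type*) [AddCommGroup V] [Module ℚ V] : ℕ∞ :=
  if Module.Finite ℚ V then (Module.finrank ℚ V : ℕ∞) else ⊤

section CoarsePart

/-- One step of a `d`-chain inside `A`. -/
def ChainStep {X : Type*} [MetricSpace X] (d : ℝ) (A : Set X) (x y : X) : Prop :=
  x ∈ A ∧ y ∈ A ∧ dist x y ≤ d

/-- `d`-chains inside `A` have diameter at most `R`. -/
def CB {X : Type*} [MetricSpace X] (d R : ℝ) (A : Set X) : Prop :=
  ∀ x y, Relation.ReflTransGen (ChainStep d A) x y → dist x y ≤ R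

/-- Asymptotic dimension of a subset at most `n`, via chains. -/
def SA {X : Type*} [MetricSpace X] (A : Set X) (n : ℕ) : Prop :=
  ∀ d : ℝ, 0 < d → ∃ R : ℝ, 0 < R ∧ ∃ U : Fin (n + 1) → Set X,
    (∀ i, CB d R (U i)) ∧ A ⊆ ⋃ i, U i

variable {X : Type*} [MetricSpace X]

lemma CB.nonneg {d R : ℝ} {A : Set X} (h : CB d R A) (x : X) : 0 ≤ R := by
  simpa using h x x .refl

lemma CB.mono {d R d' R' : ℝ} {A B : Set X} (h : CB d R A) (hd : d' ≤ d) (hR : R ≤ R')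
    (hB : B ⊆ A) : CB d' R' B := fun x y hxy =>
  (h x y (Relation.ReflTransGen.mono
    (fun _ _ hab => ⟨hB hab.1, hB hab.2.1, hab.2.2.trans hd⟩) x y hxy)).trans hR

lemma CB.iUnion {ι : Type*} {d R : ℝ} (hR : 0 ≤ R) {A : ι → Set X} (h : ∀ k, CB d R (A k))
    (hsep : ∀ k l, ∀ x ∈ A k, ∀ y ∈ A l, dist x y ≤ d → k = l) : CB d R (⋃ k, A k) := by
  intro x y hxy
  have key : x = y ∨ ∃ k, y ∈ A k ∧ Relation.ReflTransGen (ChainStep d (A k)) x y := by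
    induction hxy with
    | refl => exact Or.inl rfl
    | tail _ hbc ih =>
      rename_i b c _
      right
      obtain ⟨hb, hc, hd⟩ := hbc
      simp only [Set.mem_iUnion] at hb hc
      obtain ⟨l, hb⟩ := hb
      obtain ⟨l', hc⟩ := hc
      obtain rfl := hsep _ _ _ hb _ hc hd
      rcases ih with rfl | ⟨k, hk, hch⟩
      · exact ⟨l, hc, .single ⟨hb, hc, hd⟩⟩
      · obtain rfl := hsep _ _ _ hk _ hc hd
        exact ⟨k, hc, hch.tail ⟨hb, hc, hd⟩⟩
  rcases key with rfl | ⟨k, _, hk⟩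
  · simpa using hR
  · exact h k _ _ hk

lemma CB.union {d R : ℝ} (hR : 0 ≤ R) {A B : Set X} (hA : CB d R A) (hB : CB d R B)
    (hsep : ∀ x ∈ A, ∀ y ∈ B, ¬ dist x y ≤ d) : CB d R (A ∪ B) := by
  rw [Set.union_eq_iUnion]
  apply CB.iUnion hR
  · rintro (_ | _) <;> simpa
  · rintro (_ | _) (_ | _) x hx y hy hd
    · rfl
    · exact (hsep y (by simpa using hy) x (by simpa using hx) (by rwa [dist_comm])).elim
    · exact (hsep x (by simpa using hx) y (by simpa using hy) hd).elim
    · rfl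

lemma CB.thicken {d R r : ℝ} (hR : 0 ≤ R) (hr : 0 ≤ r) {A B : Set X} (hA : CB (d + 2 * r) R A)
    (hB : ∀ x ∈ B, ∃ a ∈ A, dist x a ≤ r) : CB d (R + 2 * r) B := by
  intro x y hxy
  have key : x = y ∨ ∀ b ∈ A, dist y b ≤ r → ∃ a, dist x a ≤ r ∧
      Relation.ReflTransGen (ChainStep (d + 2 * r) A) a b := by
    induction hxy with
    | refl => exact Or.inl rfl
    | tail hch hbc ih =>
      rename_i b c
      right
      intro e he hce
      obtain ⟨hb, hc, hd⟩ := hbc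
      obtain ⟨b', hb', hbb'⟩ := hB b hb
      have hstep : ChainStep (d + 2 * r) A b' e := by
        refine ⟨hb', he, ?_⟩
        have := dist_triangle4 b' b c e
        rw [dist_comm b' b] at this
        linarith
      rcases ih with rfl | ih
      · exact ⟨b', hbb', .single hstep⟩
      · obtain ⟨a, ha, hch⟩ := ih b' hb' hbb'
        exact ⟨a, ha, hch.tail hstep⟩
  rcases key with rfl | key
  · simp; positivity
  · rcases hxy.cases_tail with rfl | ⟨c, _, hc⟩
    · simp; positivity
    · obtain ⟨b, hb, hyb⟩ := hB y hc.2.1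
      obtain ⟨a, ha, hch⟩ := key b hb hyb
      have h1 := hA _ _ hch
      have := dist_triangle4 x a b y
      rw [dist_comm b y] at this
      linarith

lemma CB.merge {d R R' : ℝ} (hd0 : 0 ≤ d) (hR : 0 ≤ R) {A B : Set X} (hA : CB d R A)
    (hB : CB (R + 2 * d) R' B) : CB d (R' + 2 * R + 2 * d) (A ∪ B) := by
  intro x y hxy
  have hR' : 0 ≤ R' := hB.nonneg x
  -- either an A-chain, or x is close to some b, chain b to c, and c is close to y
  have key : Relation.ReflTransGen (ChainStep d A) x y ∨
      ∃ b b', dist x b ≤ R + d ∧ Relation.ReflTransGen (ChainStep (R + 2 * d) B) b b' ∧ b' ∈ B ∧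
        (y = b' ∨ ∃ a, a ∈ A ∧ y ∈ A ∧ dist b' a ≤ d ∧
          Relation.ReflTransGen (ChainStep d A) a y) := by
    induction hxy with
    | refl => exact Or.inl .refl
    | tail hch hbc ih =>
      rename_i u v
      obtain ⟨hu, hv, hd⟩ := hbc
      by_cases hvB : v ∈ B
      · right
        rcases ih with ih | ⟨b, b', hxb, hbb', hb', hrest⟩
        · refine ⟨v, v, ?_, .refl, hvB, Or.inl rfl⟩
          have := hA _ _ ih
          have := dist_triangle x u v
          linarith
        · refine ⟨b, v, hxb, hbb'.tail ⟨hb', hvB, ?_⟩, hvB, Or.inl rfl⟩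
          rcases hrest with rfl | ⟨a, _, _, hba, hau⟩
          · linarith
          · have := hA _ _ hau
            have := dist_triangle4 b' a u v
            linarith
      · have hvA : v ∈ A := hv.resolve_right hvB
        rcases ih with ih | ⟨b, b', hxb, hbb', hb', hrest⟩
        · by_cases huA : u ∈ A
          · exact Or.inl (ih.tail ⟨huA, hvA, hd⟩)
          · right
            have huB := hu.resolve_left huA
            refine ⟨u, u, ?_, .refl, huB, Or.inr ⟨v, hvA, hvA, hd, .refl⟩⟩
            have := hA _ _ ih
            linarith
        · right
          refine ⟨b, b', hxb, hbb', hb', Or.inr ?_⟩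
          rcases hrest with rfl | ⟨a, ha, huA, hba, hau⟩
          · exact ⟨v, hvA, hvA, hd, .refl⟩
          · exact ⟨a, ha, hvA, hba, hau.tail ⟨huA, hvA, hd⟩⟩
  rcases key with h | ⟨b, b', hxb, hbb', hb', hrest⟩
  · have := hA _ _ h
    linarith
  · have h1 := hB _ _ hbb'
    have h2 : dist b' y ≤ R + d := by
      rcases hrest with rfl | ⟨a, _, _, hba, hay⟩
      · simp; positivity
      · have := hA _ _ hay
        have := dist_triangle b' a y
        linarith
    have := dist_triangle4 x b b' y
    linarith

lemma SA.succ {A : Set X} {n : ℕ} (h : SA A n) : SA A (n + 1) := by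
  intro d hd
  obtain ⟨R, hR, U, hU, hc⟩ := h d hd
  refine ⟨R, hR, Fin.snoc U ∅, ?_, ?_⟩
  · intro i
    refine Fin.lastCases ?_ (fun j => ?_) i
    · rw [Fin.snoc_last]
      intro x y hxy
      rcases hxy.cases_tail with rfl | ⟨c, _, hc⟩
      · simpa using hR.le
      · exact hc.1.elim
    · rw [Fin.snoc_castSucc]; exact hU j
  · intro x hx
    obtain ⟨i, hi⟩ := Set.mem_iUnion.1 (hc hx)
    exact Set.mem_iUnion.2 ⟨i.castSucc, by rwa [Fin.snoc_castSucc]⟩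

lemma SA.le {A : Set X} {m n : ℕ} (h : SA A m) (hmn : m ≤ n) : SA A n := by
  induction hmn with
  | refl => exact h
  | step _ ih => exact ih.succ

lemma SA.subset {A B : Set X} {n : ℕ} (h : SA A n) (hB : B ⊆ A) : SA B n := by
  intro d hd
  obtain ⟨R, hR, U, hU, hc⟩ := h d hd
  exact ⟨R, hR, U, hU, hB.trans hc⟩

lemma SA.thicken {A B : Set X} {n : ℕ} (h : SA A n) {r : ℝ} (hr : 0 ≤ r)
    (hB : ∀ x ∈ B, ∃ a ∈ A, dist x a ≤ r) : SA B n := by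
  intro d hd
  obtain ⟨R, hR, U, hU, hc⟩ := h (d + 2 * r) (by positivity)
  refine ⟨R + 2 * r, by positivity, fun i => {x | ∃ a ∈ U i, dist x a ≤ r}, fun i => ?_, ?_⟩
  · exact (hU i).thicken hR.le hr fun x hx => hx
  · intro x hx
    obtain ⟨a, ha, hxa⟩ := hB x hx
    obtain ⟨i, hi⟩ := Set.mem_iUnion.1 (hc ha)
    exact Set.mem_iUnion.2 ⟨i, a, hi, hxa⟩

lemma SA.kolmogorov {A : Set X} {n : ℕ} (h : SA A n) (d : ℝ) (hd : 0 < d) :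
    ∃ R : ℝ, 0 < R ∧ ∃ U : Fin (n + 2) → Set X, (∀ i, CB d R (U i)) ∧
      ∀ x ∈ A, ∃ i j, i ≠ j ∧ x ∈ U i ∧ x ∈ U j := by
  obtain ⟨R, hR, U, hU, hc⟩ := h (d + 2 * d) (by positivity)
  let L : Set X := ⋃ i, {x | x ∈ U i ∧ ∀ j, j ≠ i → ∀ a ∈ U j, ¬ dist x a ≤ d}
  have hL : CB d R L := by
    apply CB.iUnion hR.le
    · intro k
      exact (hU k).mono (by linarith) le_rfl fun x hx => hx.1
    · intro k l x hx y hy hxy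
      by_contra hkl
      exact hx.2 l (Ne.symm hkl) y hy.1 hxy
  refine ⟨R + 2 * d, by positivity,
    Fin.snoc (fun i => {x | ∃ a ∈ U i, dist x a ≤ d}) L, ?_, ?_⟩
  · intro i
    refine Fin.lastCases ?_ (fun j => ?_) i
    · rw [Fin.snoc_last]
      exact hL.mono le_rfl (by linarith) le_rfl
    · rw [Fin.snoc_castSucc]
      exact (hU j).thicken hR.le hd.le fun x hx => hx
  · intro x hx
    obtain ⟨i, hi⟩ := Set.mem_iUnion.1 (hc hx)
    by_cases hx' : ∃ j, j ≠ i ∧ ∃ a ∈ U j, dist x a ≤ d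
    · obtain ⟨j, hji, ha⟩ := hx'
      refine ⟨j.castSucc, i.castSucc, fun h => hji (Fin.castSucc_injective _ h), ?_, ?_⟩
      · rw [Fin.snoc_castSucc]; exact ha
      · rw [Fin.snoc_castSucc]; exact ⟨x, hi, by simpa using hd.le⟩
    · push Not at hx'
      refine ⟨i.castSucc, Fin.last _, (Fin.castSucc_lt_last i).ne, ?_, ?_⟩
      · rw [Fin.snoc_castSucc]; exact ⟨x, hi, by simpa using hd.le⟩
      · rw [Fin.snoc_last]
        exact Set.mem_iUnion.2 ⟨i, hi, fun j hj a ha => not_le.2 (hx' j hj a ha)⟩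

lemma asdimLE_iff_SA {n : ℕ} : AsdimLE X n ↔ SA (Set.univ : Set X) n := by
  constructor
  · intro h d hd
    obtain ⟨R, hR, U, hb, hdis, hc⟩ := h d hd
    refine ⟨R, hR, fun i => ⋃₀ U i, fun i x y hxy => ?_, by rw [hc]⟩
    have key : x = y ∨ ∃ V ∈ U i, x ∈ V ∧ y ∈ V := by
      induction hxy with
      | refl => exact Or.inl rfl
      | tail _ hbc ih =>
        rename_i b c _
        right
        obtain ⟨⟨V, hV, hbV⟩, ⟨W, hW, hcW⟩, hd⟩ := hbc
        have hVW : V = W := by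
          by_contra hne
          exact absurd (hdis i V hV W hW hne b hbV c hcW) (not_lt.2 hd)
        subst hVW
        rcases ih with rfl | ⟨V', hV', hx, hb'⟩
        · exact ⟨V, hV, hbV, hcW⟩
        · have hVW : V' = V := by
            by_contra hne
            have := hdis i V' hV' V hV hne b hb' b hbV
            simp at this
            linarith
          subst hVW
          exact ⟨V', hV', hx, hcW⟩
    rcases key with rfl | ⟨V, hV, hx, hy⟩
    · simpa using hR.le
    · exact hb i V hV x hx y hy
  · intro h d hd
    obtain ⟨R, hR, U, hU, hc⟩ := h d hd
    have hsymm : ∀ i x y, Relation.ReflTransGen (ChainStep d (U i)) x y →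
        Relation.ReflTransGen (ChainStep d (U i)) y x := by
      intro i x y hxy
      induction hxy with
      | refl => exact .refl
      | tail _ hab ih =>
        exact Relation.ReflTransGen.head
          ⟨hab.2.1, hab.1, by rw [dist_comm]; exact hab.2.2⟩ ih
    refine ⟨R, hR, fun i => {V | ∃ x ∈ U i, V = {y | y ∈ U i ∧
      Relation.ReflTransGen (ChainStep d (U i)) x y}}, ?_, ?_, ?_⟩
    · rintro i V ⟨x, hx, rfl⟩ y hy z hz
      exact hU i _ _ ((hsymm _ _ _ hy.2).trans hz.2)
    · rintro i V ⟨x, hx, rfl⟩ W ⟨x', hx', rfl⟩ hne y hy z hz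
      by_contra hcon
      apply hne
      have hxx' : Relation.ReflTransGen (ChainStep d (U i)) x x' :=
        (hy.2.tail ⟨hy.1, hz.1, not_lt.1 hcon⟩).trans (hsymm _ _ _ hz.2)
      ext w
      exact ⟨fun hw => ⟨hw.1, (hsymm _ _ _ hxx').trans hw.2⟩,
        fun hw => ⟨hw.1, hxx'.trans hw.2⟩⟩
    · apply Set.eq_univ_of_forall
      intro x
      obtain ⟨i, hi⟩ := Set.mem_iUnion.1 (hc (Set.mem_univ x))
      exact Set.mem_iUnion.2 ⟨i, _, ⟨x, hi, rfl⟩, hi, .refl⟩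

end CoarsePart

section HeightPart

/-- `t` normalizes `N`. -/
def Nrm {G : Type*} [Group G] (N : Subgroup G) (t : G) : Prop :=
  (∀ n ∈ N, t * n * t⁻¹ ∈ N) ∧ (∀ n ∈ N, t⁻¹ * n * t ∈ N)

variable {G : Type*} [Group G]

lemma Nrm.inv {N : Subgroup G} {t : G} (h : Nrm N t) : Nrm N t⁻¹ :=
  ⟨fun n hn => by simpa using h.2 n hn, fun n hn => by simpa using h.1 n hn⟩

lemma Nrm.one (N : Subgroup G) : Nrm N 1 := ⟨by simp, by simp⟩

lemma Nrm.mul {N : Subgroup G} {s t : G} (hs : Nrm N s) (ht : Nrm N t) : Nrm N (s * t) := by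
  refine ⟨fun n hn => ?_, fun n hn => ?_⟩
  · have := hs.1 _ (ht.1 n hn)
    simpa [mul_assoc] using this
  · have := ht.2 _ (hs.2 n hn)
    simpa [mul_assoc] using this

lemma Nrm.pow {N : Subgroup G} {t : G} (h : Nrm N t) (k : ℕ) : Nrm N (t ^ k) := by
  induction k with
  | zero => simpa using Nrm.one N
  | succ k ih => rw [pow_succ]; exact ih.mul h

lemma Nrm.zpow {N : Subgroup G} {t : G} (h : Nrm N t) (k : ℤ) : Nrm N (t ^ k) := by
  cases k with
  | ofNat k => simpa using h.pow k
  | negSucc k => rw [zpow_negSucc]; exact (h.pow _).inv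

lemma Nrm.mem_sup {N : Subgroup G} {t : G} (h : Nrm N t) {x : G} :
    x ∈ N ⊔ Subgroup.zpowers t ↔ ∃ n ∈ N, ∃ k : ℤ, x = n * t ^ k := by
  constructor
  · intro hx
    let H : Subgroup G :=
      { carrier := {x | ∃ n ∈ N, ∃ k : ℤ, x = n * t ^ k}
        one_mem' := ⟨1, N.one_mem, 0, by simp⟩
        mul_mem' := by
          rintro _ _ ⟨n, hn, k, rfl⟩ ⟨m, hm, l, rfl⟩
          refine ⟨n * (t ^ k * m * (t ^ k)⁻¹), N.mul_mem hn ((h.zpow k).1 m hm), k + l, ?_⟩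
          rw [zpow_add]; group
        inv_mem' := by
          rintro _ ⟨n, hn, k, rfl⟩
          refine ⟨(t ^ k)⁻¹ * n⁻¹ * t ^ k, (h.zpow k).2 _ (N.inv_mem hn), -k, ?_⟩
          group }
    have hle : N ⊔ Subgroup.zpowers t ≤ H := by
      refine sup_le (fun n hn => ⟨n, hn, 0, by simp⟩) ?_
      rw [Subgroup.zpowers_le]
      exact ⟨1, N.one_mem, 1, by simp⟩
    exact hle hx
  · rintro ⟨n, hn, k, rfl⟩
    exact Subgroup.mul_mem_sup hn (Subgroup.zpow_mem_zpowers t k)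

/-- A height function for the pair `(N, t)`. -/
structure Height (N : Subgroup G) (t : G) (τ : G → ℤ) : Prop where
  left_N : ∀ n ∈ N, ∀ x, τ (n * x) = τ x
  left_t : ∀ x, τ (t * x) = τ x + 1
  one : τ 1 = 0

lemma Height.zpow {N : Subgroup G} {t : G} {τ : G → ℤ} (h : Height N t τ) (k : ℤ) (x : G) :
    τ (t ^ k * x) = τ x + k := by
  induction k using Int.induction_on generalizing x with
  | zero => simp
  | succ k ih =>
    rw [add_comm (k : ℤ) 1, zpow_add, zpow_one, mul_assoc, h.left_t, ih]; ring
  | pred k ih =>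
    have := h.left_t (t ^ (-(k : ℤ) - 1) * x)
    rw [← mul_assoc, ← zpow_one_add, show (1 + (-(k : ℤ) - 1)) = -k by ring, ih] at this
    linarith

lemma Height.mul {N : Subgroup G} {t : G} {τ : G → ℤ} (h : Height N t τ) (ht : Nrm N t)
    {x : G} (hx : x ∈ N ⊔ Subgroup.zpowers t) (y : G) : τ (x * y) = τ x + τ y := by
  obtain ⟨n, hn, k, rfl⟩ := ht.mem_sup.1 hx
  have h1 := h.zpow k 1
  rw [mul_one, h.one] at h1
  rw [mul_assoc, h.left_N n hn, h.left_N n hn, h.zpow, h1]; ring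

lemma exists_height {N : Subgroup G} {t : G} (ht : Nrm N t)
    (hf : ∀ k : ℤ, k ≠ 0 → t ^ k ∉ N) : ∃ τ, Height N t τ := by
  classical
  let H := N ⊔ Subgroup.zpowers t
  let rep : G → G := fun x => (Quotient.mk (QuotientGroup.rightRel H) x).out
  have hrep : ∀ x, x * (rep x)⁻¹ ∈ H := by
    intro x
    have : (QuotientGroup.rightRel H) (rep x) x := Quotient.mk_out (s := QuotientGroup.rightRel H) x
    exact QuotientGroup.rightRel_apply.1 this
  have hrep2 : ∀ h ∈ H, ∀ x, rep (h * x) = rep x := by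
    intro h hh x
    have : (Quotient.mk (QuotientGroup.rightRel H) (h * x)) =
        (Quotient.mk (QuotientGroup.rightRel H) x) := by
      apply Quotient.sound
      apply QuotientGroup.rightRel_apply.2
      have := H.inv_mem hh
      simpa using this
    simp only [rep, this]
  have hex : ∀ x, ∃ k : ℤ, ∃ n ∈ N, x * (rep x)⁻¹ = n * t ^ k := by
    intro x
    obtain ⟨n, hn, k, h⟩ := ht.mem_sup.1 (hrep x)
    exact ⟨k, n, hn, h⟩
  choose τ hτ using hex
  have huniq : ∀ (k l : ℤ) n m, n ∈ N → m ∈ N → n * t ^ k = m * t ^ l → k = l := by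
    intro k l n m hn hm he
    by_contra hkl
    apply hf (k - l) (sub_ne_zero.2 hkl)
    have : t ^ (k - l) = n⁻¹ * m := by
      rw [zpow_sub, mul_inv_eq_iff_eq_mul, mul_assoc, ← he]; group
    rw [this]
    exact N.mul_mem (N.inv_mem hn) hm
  refine ⟨fun x => τ x - τ 1, ?_, ?_, by simp⟩
  · intro n hn x
    have hnH : n ∈ H := Subgroup.mem_sup_left hn
    obtain ⟨a, ha, h1⟩ := hτ x
    obtain ⟨b, hb, h2⟩ := hτ (n * x)
    rw [hrep2 n hnH, mul_assoc, h1, ← mul_assoc] at h2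
    have := huniq _ _ _ _ (N.mul_mem hn ha) hb h2
    simp only [this]
  · intro x
    have htH : t ∈ H := Subgroup.mem_sup_right (Subgroup.mem_zpowers t)
    obtain ⟨a, ha, h1⟩ := hτ x
    obtain ⟨b, hb, h2⟩ := hτ (t * x)
    rw [hrep2 t htH, mul_assoc, h1] at h2
    have h3 : (t * a * t⁻¹) * t ^ (τ x + 1) = b * t ^ (τ (t * x)) := by
      rw [← h2, add_comm, zpow_add]; group
    have := huniq _ _ _ _ (ht.1 a ha) hb h3
    simp only [← this]; ring

end HeightPart

section UpperPart

variable {G : Type*} [Group G] [MetricSpace G]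

lemma CB.translate (hinv : ∀ g x y : G, dist (g * x) (g * y) = dist x y) {d R : ℝ} {A : Set G}
    (h : CB d R A) (g : G) : CB d R {x | g * x ∈ A} := by
  intro x y hxy
  rw [← hinv g]
  apply h
  induction hxy with
  | refl => exact .refl
  | tail _ hab ih => exact ih.tail ⟨hab.1, hab.2.1, by rw [hinv]; exact hab.2.2⟩

lemma SA.finite_step (hinv : ∀ g x y : G, dist (g * x) (g * y) = dist x y)
    {A B : Set G} {n : ℕ} (h : SA A n) (F : Set G) (hF : F.Finite)
    (hB : ∀ x ∈ B, ∃ a ∈ A, ∃ f ∈ F, x = a * f) : SA B n := by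
  obtain ⟨r, hr⟩ := (hF.image fun f => dist f 1).bddAbove
  refine h.thicken (r := max r 0) (le_max_right _ _) fun x hx => ?_
  obtain ⟨a, ha, f, hf, rfl⟩ := hB x hx
  refine ⟨a, ha, ?_⟩
  have := hinv a f 1
  rw [mul_one] at this
  rw [this]
  exact (hr ⟨f, hf, rfl⟩).trans (le_max_left _ _)

lemma SA.infinite_step (hinv : ∀ g x y : G, dist (g * x) (g * y) = dist x y)
    (hproper : ∀ (x : G) (r : ℝ), {y : G | dist x y ≤ r}.Finite)
    {N : Subgroup G} {t : G} (ht : Nrm N t)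
    (hf : ∀ k : ℤ, k ≠ 0 → t ^ k ∉ N) {n : ℕ} (h : SA (N : Set G) n) :
    SA ((N ⊔ Subgroup.zpowers t : Subgroup G) : Set G) (n + 1) := by
  obtain ⟨τ, hτ⟩ := exists_height ht hf
  set H := N ⊔ Subgroup.zpowers t with hH
  have htz : ∀ k : ℤ, t ^ k ∈ H := fun k =>
    Subgroup.mem_sup_right (Subgroup.zpow_mem_zpowers t k)
  have slab : ∀ M : ℤ, SA {x | x ∈ H ∧ 0 ≤ τ x ∧ τ x < M} n := by
    intro M
    refine h.finite_step hinv ((fun k : ℤ => t ^ k) '' Set.Ico 0 M) ((Set.finite_Ico 0 M).image _) ?_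
    rintro x ⟨hx, h0, hM⟩
    obtain ⟨a, ha, k, rfl⟩ := ht.mem_sup.1 hx
    have h1 := hτ.zpow k 1
    rw [mul_one, hτ.one] at h1
    rw [hτ.left_N a ha, h1] at h0 hM
    exact ⟨a, ha, _, ⟨k, ⟨by linarith, by linarith⟩, rfl⟩, rfl⟩
  intro d hd
  obtain ⟨w, hw0, hw⟩ : ∃ w : ℤ, 0 < w ∧ ∀ x ∈ H, ∀ y ∈ H, dist x y ≤ d → |τ x - τ y| < w := by
    obtain ⟨r, hr⟩ := ((hproper 1 d).image fun y => |τ y|).bddAbove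
    refine ⟨max r 0 + 1, by positivity, fun x hx y hy hxy => ?_⟩
    have h1 : dist 1 (x⁻¹ * y) ≤ d := by
      rw [← hinv x]; simpa using hxy
    have h2 := hr ⟨_, h1, rfl⟩
    have h3 := hτ.mul ht hx (x⁻¹ * y)
    rw [mul_inv_cancel_left] at h3
    have h4 : τ x - τ y = - τ (x⁻¹ * y) := by linarith
    rw [h4, abs_neg]
    have := le_max_left r 0
    simp only at h2
    linarith
  set M : ℤ := (n + 3) * w with hM
  have hM0 : 0 < M := by positivity
  obtain ⟨R, hR, A, hA, hcA⟩ := (slab M).kolmogorov d hd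
  obtain ⟨R', hR', W, hW, hcW⟩ := (slab w).succ (R + 2 * d) (by positivity)
  let P : Fin (n + 2) → Set G := fun i =>
    {x | x ∈ H ∧ t ^ M * x ∈ A i ∧ -M + ((i : ℕ) + 2 : ℤ) * w ≤ τ x ∧ τ x < 0}
  let Q : Fin (n + 2) → Set G := fun i =>
    {x | x ∈ H ∧ x ∈ A i ∧ w ≤ τ x ∧ τ x < ((i : ℕ) + 1 : ℤ) * w}
  let V : Fin (n + 2) → Set G := fun i =>
    {x | x ∈ H ∧ x ∈ W i ∧ 0 ≤ τ x ∧ τ x < w}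
  have hY : ∀ i, CB d (R' + 2 * R + 2 * d) ((P i ∪ Q i) ∪ V i) := by
    intro i
    apply CB.merge hd.le hR.le
    · apply CB.union hR.le
      · exact ((hA i).translate hinv (t ^ M)).mono le_rfl le_rfl fun x hx => hx.2.1
      · exact (hA i).mono le_rfl le_rfl fun x hx => hx.2.1
      · intro x hx y hy hxy
        have := abs_lt.1 (hw x hx.1 y hy.1 hxy)
        have h1 := hx.2.2.2
        have h2 := hy.2.2.1
        linarith
    · exact (hW i).mono le_rfl le_rfl fun x hx => hx.2.1
  have hYrange : ∀ i, ∀ x ∈ (P i ∪ Q i) ∪ V i, x ∈ H ∧ -M + ((i : ℕ) + 2 : ℤ) * w ≤ τ x ∧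
      τ x < ((i : ℕ) + 1 : ℤ) * w := by
    intro i x hx
    have hi : (((i : ℕ) : ℤ) + 2) * w ≤ M := by
      rw [hM]
      apply mul_le_mul_of_nonneg_right _ hw0.le
      have := i.2
      omega
    have hi0 : w ≤ (((i : ℕ) : ℤ) + 1) * w := by nlinarith [Int.natCast_nonneg (i : ℕ)]
    rcases hx with (hx | hx) | hx
    · exact ⟨hx.1, hx.2.2.1, by linarith [hx.2.2.2]⟩
    · exact ⟨hx.1, by linarith [hx.2.2.1], hx.2.2.2⟩
    · exact ⟨hx.1, by linarith [hx.2.2.1], by linarith [hx.2.2.2]⟩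
  have hnn : 0 ≤ R' + 2 * R + 2 * d := by positivity
  refine ⟨R' + 2 * R + 2 * d, by positivity,
    fun i => ⋃ k : ℤ, {x | t ^ (k * M) * x ∈ (P i ∪ Q i) ∪ V i}, fun i => ?_, ?_⟩
  · apply CB.iUnion hnn
    · intro k
      exact (hY i).translate hinv _
    · have key : ∀ k l x y, t ^ (k * M) * x ∈ (P i ∪ Q i) ∪ V i →
          t ^ (l * M) * y ∈ (P i ∪ Q i) ∪ V i → dist x y ≤ d → k ≤ l := by
        intro k l x y hx hy hxy
        obtain ⟨hx0, hx1, hx2⟩ := hYrange i _ hx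
        obtain ⟨hy0, hy1, hy2⟩ := hYrange i _ hy
        rw [Subgroup.mul_mem_cancel_left _ (htz _)] at hx0 hy0
        rw [hτ.zpow] at hx1 hx2 hy1 hy2
        have := abs_lt.1 (hw x hx0 y hy0 hxy)
        by_contra hlk
        have : (l + 1) * M ≤ k * M := mul_le_mul_of_nonneg_right (by omega) hM0.le
        linarith
      intro k l x hx y hy hxy
      exact le_antisymm (key _ _ _ _ hx hy hxy) (key _ _ _ _ hy hx (by rwa [dist_comm]))
  · intro x hx
    set k : ℤ := τ x / M
    have h0 : 0 ≤ τ (t ^ (-(k * M)) * x) := by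
      rw [hτ.zpow]
      have := Int.ediv_mul_le (τ x) hM0.ne'
      change k * M ≤ _ at this
      linarith
    have h1 : τ (t ^ (-(k * M)) * x) < M := by
      rw [hτ.zpow]
      have := Int.lt_ediv_add_one_mul_self (τ x) hM0
      change τ x < (k + 1) * M at this
      linarith
    have hxH : t ^ (-(k * M)) * x ∈ H := H.mul_mem (htz _) hx
    set x' := t ^ (-(k * M)) * x with hx'
    by_cases hlt : τ x' < w
    · obtain ⟨i, hi⟩ := Set.mem_iUnion.1 (hcW ⟨hxH, h0, hlt⟩)
      refine Set.mem_iUnion.2 ⟨i, Set.mem_iUnion.2 ⟨-k, Or.inr ?_⟩⟩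
      rw [neg_mul, ← hx']
      exact ⟨hxH, hi, h0, hlt⟩
    · push Not at hlt
      have fin : ∀ i : Fin (n + 2), x' ∈ A i →
          (τ x' < ((i : ℕ) + 1 : ℤ) * w ∨ ((i : ℕ) + 2 : ℤ) * w ≤ τ x') →
          x ∈ ⋃ i, ⋃ k : ℤ, {x | t ^ (k * M) * x ∈ (P i ∪ Q i) ∪ V i} := by
        intro i hi hor
        rcases hor with hor | hor
        · refine Set.mem_iUnion.2 ⟨i, Set.mem_iUnion.2 ⟨-k, Or.inl (Or.inr ?_)⟩⟩
          rw [neg_mul, ← hx']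
          exact ⟨hxH, hi, hlt, hor⟩
        · refine Set.mem_iUnion.2 ⟨i, Set.mem_iUnion.2 ⟨-k - 1, Or.inl (Or.inl ?_)⟩⟩
          have e : t ^ ((-k - 1) * M) * x = t ^ (-M) * x' := by
            rw [hx', ← mul_assoc (t ^ (-M)), ← zpow_add]; congr 2; ring
          rw [e]
          refine ⟨H.mul_mem (htz _) hxH, ?_, ?_, ?_⟩
          · rw [← mul_assoc, ← zpow_add]; simpa using hi
          · rw [hτ.zpow]; linarith
          · rw [hτ.zpow]; linarith
      obtain ⟨i, j, hij, hi, hj⟩ := hcA x' ⟨hxH, h0, h1⟩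
      by_cases ci : (τ x' < ((i : ℕ) + 1 : ℤ) * w ∨ ((i : ℕ) + 2 : ℤ) * w ≤ τ x')
      · exact fin i hi ci
      by_cases cj : (τ x' < ((j : ℕ) + 1 : ℤ) * w ∨ ((j : ℕ) + 2 : ℤ) * w ≤ τ x')
      · exact fin j hj cj
      exfalso
      push Not at ci cj
      have a1 : ((i : ℕ) + 1 : ℤ) < ((j : ℕ) + 2 : ℤ) :=
        lt_of_mul_lt_mul_right (ci.1.trans_lt cj.2) hw0.le
      have a2 : ((j : ℕ) + 1 : ℤ) < ((i : ℕ) + 2 : ℤ) :=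
        lt_of_mul_lt_mul_right (cj.1.trans_lt ci.2) hw0.le
      apply hij
      ext
      omega

end UpperPart

section ExtPart

/-- The exterior algebra on the free abelian group on `G`. -/
abbrev EL (G : Type*) := ExteriorAlgebra ℤ (G →₀ ℤ)

/-- Augmentation. -/
noncomputable def eps (G : Type*) : Module.Dual ℤ (G →₀ ℤ) :=
  Finsupp.linearCombination ℤ (fun _ => (1 : ℤ))

/-- The boundary operator. -/
noncomputable def bd (G : Type*) : EL G →ₗ[ℤ] EL G :=
  CliffordAlgebra.contractLeft (Q := (0 : QuadraticForm ℤ (G →₀ ℤ))) (eps G)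

/-- The generator of the exterior algebra. -/
noncomputable def io {G : Type*} : (G →₀ ℤ) →ₗ[ℤ] EL G := ExteriorAlgebra.ι ℤ

/-- basis elements -/
noncomputable def bs {G : Type*} (x : G) : EL G := io (Finsupp.single x (1 : ℤ))

/-- algebra map induced by a function. -/
noncomputable def act {G : Type*} (f : G → G) : EL G →ₐ[ℤ] EL G :=
  ExteriorAlgebra.map (Finsupp.lmapDomain ℤ ℤ f)

variable {G : Type*}

lemma bd_io_mul (v : G →₀ ℤ) (y : EL G) : bd G (io v * y) = eps G v • y - io v * bd G y :=
  CliffordAlgebra.contractLeft_ι_mul _ _ _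

lemma bd_bd (y : EL G) : bd G (bd G y) = 0 :=
  CliffordAlgebra.contractLeft_contractLeft _ _

lemma bd_algebraMap (r : ℤ) : bd G (algebraMap ℤ _ r) = 0 :=
  CliffordAlgebra.contractLeft_algebraMap _ _ _

lemma bd_io (v : G →₀ ℤ) : bd G (io v) = algebraMap ℤ _ (eps G v) :=
  CliffordAlgebra.contractLeft_ι _ _ _

lemma eps_single (x : G) (n : ℤ) : eps G (Finsupp.single x n) = n := by
  simp [eps]

lemma bd_bs_mul (x : G) (y : EL G) : bd G (bs x * y) = y - bs x * bd G y := by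
  rw [bs, bd_io_mul, eps_single, one_smul]

lemma io_sq (v : G →₀ ℤ) : io v * io v = 0 := ExteriorAlgebra.ι_sq_zero v

lemma act_io (f : G → G) (v : G →₀ ℤ) : act f (io v) = io (Finsupp.mapDomain f v) :=
  ExteriorAlgebra.map_apply_ι _ _

lemma act_bs (f : G → G) (x : G) : act f (bs x) = bs (f x) := by
  rw [bs, act_io, Finsupp.mapDomain_single]; rfl

lemma EL_algHom_ext {f g : EL G →ₐ[ℤ] EL G}
    (h : ∀ x, f (bs x) = g (bs x)) : f = g := by
  apply ExteriorAlgebra.hom_ext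
  refine Finsupp.lhom_ext fun x n => ?_
  have e : Finsupp.single x n = n • (Finsupp.single x (1 : ℤ)) := by
    rw [Finsupp.smul_single, smul_eq_mul, mul_one]
  have hx := h x
  change f (ExteriorAlgebra.ι ℤ _) = g (ExteriorAlgebra.ι ℤ _) at hx
  rw [e, map_smul, map_smul]
  simp only [LinearMap.comp_apply, AlgHom.toLinearMap_apply, hx]

/-- Induction on products of basis elements, multiplying from the left. -/
lemma EL_induction {P : EL G → Prop} (hadd : ∀ x y, P x → P y → P (x + y))
    (hsmul : ∀ (n : ℤ) x, P x → P (n • x)) (hone : P 1) (hmul : ∀ x y, P y → P (bs x * y))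
    (y : EL G) : P y := by
  have hzero : P 0 := by simpa using hsmul 0 1 hone
  suffices h : ∀ z y : EL G, P y → P (z * y) by simpa using h y 1 hone
  intro z
  induction z using ExteriorAlgebra.induction with
  | algebraMap r => intro y hy; rw [← Algebra.smul_def]; exact hsmul _ _ hy
  | ι v =>
    intro y hy
    change P (io v * y)
    induction v using Finsupp.induction_linear with
    | zero => simpa using hzero
    | add v w hv hw => rw [map_add, add_mul]; exact hadd _ _ hv hw
    | single x n =>
      have : io (Finsupp.single x n) = n • (bs x : EL G) := by
        rw [bs, ← map_smul, Finsupp.smul_single, smul_eq_mul, mul_one]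
      rw [this, smul_mul_assoc]
      exact hsmul _ _ (hmul x y hy)
  | mul a b ha hb => intro y hy; rw [mul_assoc]; exact ha _ (hb _ hy)
  | add a b ha hb => intro y hy; rw [add_mul]; exact hadd _ _ (ha _ hy) (hb _ hy)

lemma bd_act (f : G → G) (y : EL G) : bd G (act f y) = act f (bd G y) := by
  induction y using EL_induction with
  | hadd x y hx hy => simp [hx, hy]
  | hsmul n x hx => rw [map_smul, map_smul, map_smul, map_smul, hx]
  | hone =>
    have := bd_algebraMap (G := G) 1
    rw [map_one] at this
    rw [map_one, this, map_zero]
  | hmul x y hy => rw [map_mul, act_bs, bd_bs_mul, bd_bs_mul, map_sub, map_mul, act_bs, hy]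

lemma act_act (f g : G → G) (y : EL G) : act f (act g y) = act (f ∘ g) y := by
  have : (act f).comp (act g) = act (f ∘ g) := by
    apply EL_algHom_ext
    intro x
    simp [act_bs]
  exact DFunLike.congr_fun this y

lemma act_ident (y : EL G) : act id y = y := by
  have : act (id : G → G) = AlgHom.id ℤ _ := by
    apply EL_algHom_ext
    intro x
    simp [act_bs]
  exact DFunLike.congr_fun this y

/-- degree k projection -/
noncomputable def pr (k : ℕ) : EL G →ₗ[ℤ] EL G :=
  GradedAlgebra.proj (fun i : ℕ => ⋀[ℤ]^i (G →₀ ℤ)) k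

lemma pr_mem (k : ℕ) (y : EL G) : pr k y ∈ ⋀[ℤ]^k (G →₀ ℤ) := by
  rw [pr, GradedAlgebra.proj_apply]
  exact SetLike.coe_mem _

lemma pr_same {k : ℕ} {y : EL G} (hy : y ∈ ⋀[ℤ]^k (G →₀ ℤ)) : pr k y = y := by
  rw [pr, GradedAlgebra.proj_apply]
  exact DirectSum.decompose_of_mem_same _ hy

lemma pr_ne {k l : ℕ} {y : EL G} (hy : y ∈ ⋀[ℤ]^k (G →₀ ℤ)) (h : k ≠ l) : pr l y = 0 := by
  rw [pr, GradedAlgebra.proj_apply]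
  exact DirectSum.decompose_of_mem_ne _ hy h

lemma EL_hom_induction {P : EL G → Prop} (hadd : ∀ x y, P x → P y → P (x + y))
    (hom : ∀ k, ∀ x ∈ ⋀[ℤ]^k (G →₀ ℤ), P x) (y : EL G) : P y := by
  induction y using DirectSum.Decomposition.inductionOn (fun i : ℕ => ⋀[ℤ]^i (G →₀ ℤ)) with
  | zero => exact hom 0 0 (Submodule.zero_mem _)
  | homogeneous m => exact hom _ _ m.2
  | add x y hx hy => exact hadd _ _ hx hy

lemma algebraMap_mem_deg (r : ℤ) : algebraMap ℤ (EL G) r ∈ ⋀[ℤ]^0 (G →₀ ℤ) := by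
  change _ ∈ (LinearMap.range (ExteriorAlgebra.ι ℤ : (G →₀ ℤ) →ₗ[ℤ] EL G)) ^ 0
  rw [pow_zero]
  exact Submodule.algebraMap_mem r

lemma io_mem_deg (v : G →₀ ℤ) : (io v : EL G) ∈ ⋀[ℤ]^1 (G →₀ ℤ) := by
  change _ ∈ (LinearMap.range (ExteriorAlgebra.ι ℤ : (G →₀ ℤ) →ₗ[ℤ] EL G)) ^ 1
  rw [pow_one]
  exact ⟨v, rfl⟩

lemma io_mul_mem_deg (v : G →₀ ℤ) {k : ℕ} {y : EL G} (hy : y ∈ ⋀[ℤ]^k (G →₀ ℤ)) :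
    (io v * y : EL G) ∈ ⋀[ℤ]^(k+1) (G →₀ ℤ) := by
  change _ ∈ (LinearMap.range (ExteriorAlgebra.ι ℤ : (G →₀ ℤ) →ₗ[ℤ] EL G)) ^ (k + 1)
  rw [pow_succ']
  exact Submodule.mul_mem_mul ⟨v, rfl⟩ hy

/-- Induction in a fixed degree. -/
lemma EL_deg_induction {P : ℕ → EL G → Prop} (hzero : ∀ k, P k 0) (hadd : ∀ k x y, P k x → P k y → P k (x + y))
    (hsmul : ∀ k (n : ℤ) x, P k x → P k (n • x)) (hone : P 0 1)
    (hmul : ∀ k x y, y ∈ ⋀[ℤ]^k (G →₀ ℤ) → P k y → P (k + 1) (bs x * y))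
    (k : ℕ) (y : EL G) (hy : y ∈ ⋀[ℤ]^k (G →₀ ℤ)) : P k y := by
  induction k generalizing y with
  | zero =>
    change _ ∈ (LinearMap.range (ExteriorAlgebra.ι ℤ : (G →₀ ℤ) →ₗ[ℤ] EL G)) ^ 0 at hy
    rw [pow_zero, Submodule.mem_one] at hy
    obtain ⟨r, rfl⟩ := hy
    rw [Algebra.algebraMap_eq_smul_one]
    exact hsmul _ _ _ hone
  | succ k ih =>
    change _ ∈ (LinearMap.range (ExteriorAlgebra.ι ℤ : (G →₀ ℤ) →ₗ[ℤ] EL G)) ^ (k + 1) at hy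
    rw [pow_succ'] at hy
    induction hy using Submodule.mul_induction_on' with
    | mem_mul_mem m hm n hn =>
      obtain ⟨v, rfl⟩ := hm
      change P (k + 1) (io v * n)
      induction v using Finsupp.induction_linear with
      | zero =>
        rw [map_zero, zero_mul]; exact hzero _
      | add v w hv hw => rw [map_add, add_mul]; exact hadd _ _ _ hv hw
      | single x l =>
        have : io (Finsupp.single x l) = l • (bs x : EL G) := by
          rw [bs, ← map_smul, Finsupp.smul_single, smul_eq_mul, mul_one]
        rw [this, smul_mul_assoc]
        exact hsmul _ _ _ (hmul _ _ _ hn (ih _ hn))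
    | add x _ y _ hx hy => exact hadd _ _ _ hx hy

lemma act_mem_deg (f : G → G) {k : ℕ} {y : EL G} (hy : y ∈ ⋀[ℤ]^k (G →₀ ℤ)) :
    act f y ∈ ⋀[ℤ]^k (G →₀ ℤ) := by
  refine EL_deg_induction (P := fun k y => act f y ∈ ⋀[ℤ]^k (G →₀ ℤ)) ?_ ?_ ?_ ?_ ?_ k y hy
  · intro k; rw [map_zero]; exact Submodule.zero_mem _
  · intro k x y hx hy; rw [map_add]; exact Submodule.add_mem _ hx hy
  · intro k n x hx; rw [map_smul]; exact Submodule.smul_mem _ _ hx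
  · have := algebraMap_mem_deg (G := G) 1
    rw [map_one] at this ⊢
    exact this
  · intro k x y _ hy; rw [map_mul, act_bs]; exact io_mul_mem_deg _ hy

lemma bd_mem_deg' {k : ℕ} {y : EL G} (hy : y ∈ ⋀[ℤ]^k (G →₀ ℤ)) :
    (k = 0 → bd G y = 0) ∧ ∀ j, k = j + 1 → bd G y ∈ ⋀[ℤ]^j (G →₀ ℤ) := by
  refine EL_deg_induction (P := fun k y => (k = 0 → bd G y = 0) ∧ ∀ j, k = j + 1 →
    bd G y ∈ ⋀[ℤ]^j (G →₀ ℤ)) ?_ ?_ ?_ ?_ ?_ k y hy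
  · intro k; rw [map_zero]; exact ⟨fun _ => rfl, fun _ _ => Submodule.zero_mem _⟩
  · intro k x y hx hy
    rw [map_add]
    exact ⟨fun h => by rw [hx.1 h, hy.1 h, add_zero],
      fun j h => Submodule.add_mem _ (hx.2 j h) (hy.2 j h)⟩
  · intro k n x hx; rw [map_smul]
    exact ⟨fun h => by rw [hx.1 h, smul_zero], fun j h => Submodule.smul_mem _ _ (hx.2 j h)⟩
  · have := bd_algebraMap (G := G) 1
    rw [map_one] at this
    exact ⟨fun _ => this, fun j h => by omega⟩
  · intro k x y hyk hy
    refine ⟨fun h => by omega, fun j h => ?_⟩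
    obtain rfl : k = j := by omega
    rw [bd_bs_mul]
    refine Submodule.sub_mem _ hyk ?_
    cases k with
    | zero => rw [hy.1 rfl, mul_zero]; exact Submodule.zero_mem _
    | succ k => exact io_mul_mem_deg _ (hy.2 k rfl)

lemma bd_mem_deg {k : ℕ} {y : EL G} (hy : y ∈ ⋀[ℤ]^(k+1) (G →₀ ℤ)) :
    bd G y ∈ ⋀[ℤ]^k (G →₀ ℤ) := (bd_mem_deg' hy).2 k rfl

lemma pr_act (k : ℕ) (f : G → G) (y : EL G) : pr k (act f y) = act f (pr k y) := by
  induction y using EL_hom_induction with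
  | hadd x y hx hy => simp only [map_add, hx, hy]
  | hom l y hy =>
    by_cases h : l = k
    · subst h
      rw [pr_same hy, pr_same (act_mem_deg f hy)]
    · rw [pr_ne hy h, pr_ne (act_mem_deg f hy) h, map_zero]

lemma pr_bd (k : ℕ) (y : EL G) : pr k (bd G y) = bd G (pr (k + 1) y) := by
  induction y using EL_hom_induction with
  | hadd x y hx hy => simp only [map_add, hx, hy]
  | hom l y hy =>
    cases l with
    | zero => rw [(bd_mem_deg' hy).1 rfl, pr_ne hy (by omega), map_zero, map_zero]
    | succ l =>
      by_cases h : l = k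
      · subst h
        rw [pr_same hy, pr_same (bd_mem_deg hy)]
      · rw [pr_ne hy (by omega), pr_ne (bd_mem_deg hy) h, map_zero]

end ExtPart

section HomPart

variable {G : Type*} [Group G]

/-- left translation -/
noncomputable abbrev la (g : G) : EL G →ₐ[ℤ] EL G := act (fun x => g * x)

lemma la_la (g h : G) (y : EL G) : la g (la h y) = la (g * h) y := by
  rw [la, la, act_act]
  congr 2
  funext x
  simp [mul_assoc]

lemma la_one (y : EL G) : la 1 y = y := by
  have : (fun x : G => 1 * x) = id := by funext x; simp
  rw [la, this, act_ident]

/-- Coinvariant boundary together with constants. -/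
noncomputable def BB (H : Subgroup G) : Submodule ℤ (EL G) :=
  Submodule.span ℤ ({x | ∃ g ∈ H, ∃ y, x = y - la g y} ∪ Set.range (algebraMap ℤ (EL G)))

/-- Boundaries of the coinvariant complex. -/
noncomputable def EE (H : Subgroup G) : Submodule ℤ (EL G) :=
  BB H ⊔ LinearMap.range (bd G)

lemma BB_sub {H : Subgroup G} {g : G} (hg : g ∈ H) (y : EL G) : y - la g y ∈ BB H :=
  Submodule.subset_span (Or.inl ⟨g, hg, y, rfl⟩)

lemma BB_alg (H : Subgroup G) (r : ℤ) : algebraMap ℤ (EL G) r ∈ BB H :=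
  Submodule.subset_span (Or.inr ⟨r, rfl⟩)

lemma BB_map {H K : Subgroup G} (L : EL G →ₗ[ℤ] EL G)
    (h1 : ∀ g ∈ H, ∀ y, L (y - la g y) ∈ BB K) (h2 : ∀ r, L (algebraMap ℤ _ r) ∈ BB K)
    {x : EL G} (hx : x ∈ BB H) : L x ∈ BB K := by
  have : BB H ≤ (BB K).comap L := by
    apply Submodule.span_le.2
    rintro _ (⟨g, hg, y, rfl⟩ | ⟨r, rfl⟩)
    · exact h1 g hg y
    · exact h2 r
  exact this hx

lemma BB_mono {H K : Subgroup G} (h : H ≤ K) : BB H ≤ BB K := fun _ hx =>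
  BB_map LinearMap.id (fun g hg y => BB_sub (h hg) y) (fun r => BB_alg K r) hx

lemma BB_bd {H : Subgroup G} {x : EL G} (hx : x ∈ BB H) : bd G x ∈ BB H := by
  refine BB_map (bd G) (fun g hg y => ?_) (fun r => ?_) hx
  · rw [map_sub, bd_act]; exact BB_sub hg _
  · rw [bd_algebraMap]; exact Submodule.zero_mem _

lemma BB_la {H : Subgroup G} {s : G} (hs : Nrm H s) {x : EL G} (hx : x ∈ BB H) :
    la s x ∈ BB H := by
  refine BB_map (la s).toLinearMap (fun g hg y => ?_) (fun r => ?_) hx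
  · have := BB_sub (hs.1 g hg) (la s y)
    rw [la_la] at this
    rw [AlgHom.toLinearMap_apply, map_sub, la_la]
    simpa using this
  · rw [AlgHom.toLinearMap_apply, AlgHom.commutes]; exact BB_alg _ _

lemma BB_pr {H : Subgroup G} (k : ℕ) {x : EL G} (hx : x ∈ BB H) : pr k x ∈ BB H := by
  refine BB_map (pr k) (fun g hg y => ?_) (fun r => ?_) hx
  · rw [map_sub, pr_act]; exact BB_sub hg _
  · by_cases h : 0 = k
    · subst h
      rw [pr_same (algebraMap_mem_deg r)]; exact BB_alg _ _
    · rw [pr_ne (algebraMap_mem_deg r) h]; exact Submodule.zero_mem _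

lemma BB_le_EE (H : Subgroup G) : BB H ≤ EE H := le_sup_left

lemma bd_mem_EE (H : Subgroup G) (w : EL G) : bd G w ∈ EE H :=
  Submodule.mem_sup_right ⟨w, rfl⟩

lemma EE_mono {H K : Subgroup G} (h : H ≤ K) : EE H ≤ EE K := sup_le_sup_right (BB_mono h) _

lemma mem_EE {H : Subgroup G} {x : EL G} : x ∈ EE H ↔ ∃ b ∈ BB H, ∃ w, x = b + bd G w := by
  rw [EE, Submodule.mem_sup]
  constructor
  · rintro ⟨b, hb, _, ⟨w, rfl⟩, rfl⟩; exact ⟨b, hb, w, rfl⟩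
  · rintro ⟨b, hb, w, rfl⟩; exact ⟨b, hb, _, ⟨w, rfl⟩, rfl⟩

lemma mem_EE_deg {H : Subgroup G} {k : ℕ} {x : EL G} (hx : x ∈ ⋀[ℤ]^k (G →₀ ℤ))
    (h : x ∈ EE H) : ∃ b ∈ BB H, ∃ w ∈ ⋀[ℤ]^(k+1) (G →₀ ℤ), x = b + bd G w := by
  obtain ⟨b, hb, w, rfl⟩ := mem_EE.1 h
  refine ⟨pr k b, BB_pr k hb, pr (k + 1) w, pr_mem _ _, ?_⟩
  rw [← pr_bd, ← map_add, pr_same hx]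

lemma EE_la {H : Subgroup G} {s : G} (hs : Nrm H s) {x : EL G} (hx : x ∈ EE H) :
    la s x ∈ EE H := by
  obtain ⟨b, hb, w, rfl⟩ := mem_EE.1 hx
  refine mem_EE.2 ⟨la s b, BB_la hs hb, la s w, ?_⟩
  rw [map_add, bd_act]

lemma BB_sup {N : Subgroup G} {s : G} {x : EL G} (hx : x ∈ BB (N ⊔ Subgroup.zpowers s)) :
    ∃ b ∈ BB N, ∃ u, x = b + (u - la s u) := by
  let L : EL G →ₗ[ℤ] EL G := LinearMap.id - (la s).toLinearMap
  have hL : ∀ u, L u = u - la s u := fun u => rfl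
  suffices h : x ∈ BB N ⊔ LinearMap.range L by
    obtain ⟨b, hb, _, ⟨u, rfl⟩, rfl⟩ := Submodule.mem_sup.1 h
    exact ⟨b, hb, u, rfl⟩
  set C := BB N ⊔ LinearMap.range L with hC
  let S : Subgroup G :=
    { carrier := {g | ∀ y : EL G, y - la g y ∈ C}
      one_mem' := by intro y; rw [la_one, sub_self]; exact C.zero_mem
      mul_mem' := by
        intro a b ha hb y
        have := C.add_mem (ha (la b y)) (hb y)
        rw [la_la] at this
        have e : y - la (a * b) y = la b y - la (a * b) y + (y - la b y) := by abel
        rw [e]; exact this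
      inv_mem' := by
        intro a ha y
        have := C.neg_mem (ha (la a⁻¹ y))
        rw [la_la, mul_inv_cancel, la_one, neg_sub] at this
        exact this }
  have hle : N ⊔ Subgroup.zpowers s ≤ S := by
    refine sup_le (fun n hn y => Submodule.mem_sup_left (BB_sub hn y)) ?_
    rw [Subgroup.zpowers_le]
    intro y
    exact Submodule.mem_sup_right ⟨y, rfl⟩
  have : BB (N ⊔ Subgroup.zpowers s) ≤ C := by
    apply Submodule.span_le.2
    rintro _ (⟨g, hg, y, rfl⟩ | ⟨r, rfl⟩)
    · exact hle hg y
    · exact Submodule.mem_sup_left (BB_alg N r)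
  exact this hx

open Classical in
/-- Truncation with respect to a height. -/
noncomputable def tr (τ : G → ℤ) (k : ℤ) : EL G →ₐ[ℤ] EL G :=
  ExteriorAlgebra.map (Finsupp.linearCombination ℤ
    (fun x => if k ≤ τ x then Finsupp.single x (1 : ℤ) else 0))

open Classical in
lemma tr_bs (τ : G → ℤ) (k : ℤ) (x : G) :
    tr τ k (bs x) = if k ≤ τ x then bs x else 0 := by
  rw [tr, bs, io, ExteriorAlgebra.map_apply_ι, Finsupp.linearCombination_single, one_smul]
  split_ifs
  · rfl
  · exact map_zero _

lemma tr_la_N {N : Subgroup G} {s : G} {τ : G → ℤ} (hτ : Height N s τ) {n : G} (hn : n ∈ N)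
    (k : ℤ) (y : EL G) : tr τ k (la n y) = la n (tr τ k y) := by
  have : (tr τ k).comp (la n) = (la n).comp (tr τ k) := by
    apply EL_algHom_ext
    intro x
    rw [AlgHom.comp_apply, AlgHom.comp_apply, act_bs, tr_bs, tr_bs, hτ.left_N n hn]
    split_ifs
    · rw [act_bs]
    · rw [map_zero]
  exact DFunLike.congr_fun this y

lemma tr_la_s {N : Subgroup G} {s : G} {τ : G → ℤ} (hτ : Height N s τ)
    (k : ℤ) (y : EL G) : tr τ (k + 1) (la s y) = la s (tr τ k y) := by
  have : (tr τ (k + 1)).comp (la s) = (la s).comp (tr τ k) := by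
    apply EL_algHom_ext
    intro x
    rw [AlgHom.comp_apply, AlgHom.comp_apply, act_bs, tr_bs, tr_bs, hτ.left_t]
    simp only [add_le_add_iff_right]
    split_ifs
    · rw [act_bs]
    · rw [map_zero]
  exact DFunLike.congr_fun this y

lemma tr_bounds (τ : G → ℤ) (c : EL G) : ∃ K : ℤ, (∀ k ≤ -K, tr τ k c = c) ∧
    ∀ k ≥ K, ∃ r, tr τ k c = algebraMap ℤ _ r := by
  induction c using EL_induction with
  | hadd x y hx hy =>
    obtain ⟨K, h1, h2⟩ := hx
    obtain ⟨L, h3, h4⟩ := hy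
    refine ⟨max K L, fun k hk => ?_, fun k hk => ?_⟩
    · rw [map_add, h1 k (by omega), h3 k (by omega)]
    · obtain ⟨r, hr⟩ := h2 k (by omega)
      obtain ⟨r', hr'⟩ := h4 k (by omega)
      exact ⟨r + r', by rw [map_add, hr, hr', map_add]⟩
  | hsmul n x hx =>
    obtain ⟨K, h1, h2⟩ := hx
    refine ⟨K, fun k hk => ?_, fun k hk => ?_⟩
    · rw [map_smul, h1 k hk]
    · obtain ⟨r, hr⟩ := h2 k hk
      exact ⟨n * r, by rw [map_smul, hr, map_mul, Algebra.smul_def]⟩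
  | hone => exact ⟨0, fun k _ => map_one _, fun k _ => ⟨1, by rw [map_one, map_one]⟩⟩
  | hmul x y hy =>
    obtain ⟨K, h1, h2⟩ := hy
    refine ⟨max K (|τ x| + 1), fun k hk => ?_, fun k hk => ?_⟩
    · have := neg_abs_le (τ x)
      rw [map_mul, tr_bs, if_pos (by omega), h1 k (by omega)]
    · have := le_abs_self (τ x)
      exact ⟨0, by rw [map_mul, tr_bs, if_neg (by omega), zero_mul, map_zero]⟩

lemma BB_tr {N : Subgroup G} {s : G} {τ : G → ℤ} (hτ : Height N s τ) (k : ℤ) {x : EL G}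
    (hx : x ∈ BB N) : tr τ k x ∈ BB N := by
  refine BB_map (tr τ k).toLinearMap (fun g hg y => ?_) (fun r => ?_) hx
  · rw [AlgHom.toLinearMap_apply, map_sub, tr_la_N hτ hg]; exact BB_sub hg _
  · rw [AlgHom.toLinearMap_apply, AlgHom.commutes]; exact BB_alg _ _

lemma BB_inj {N : Subgroup G} {s : G} (hs : Nrm N s) (hf : ∀ k : ℤ, k ≠ 0 → s ^ k ∉ N)
    {c : EL G} (hc : c - la s c ∈ BB N) : c ∈ BB N := by
  obtain ⟨τ, hτ⟩ := exists_height hs hf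
  obtain ⟨K, h1, h2⟩ := tr_bounds τ c
  have key : ∀ j : ℕ, tr τ (|K| - j) c ∈ BB N := by
    intro j
    induction j with
    | zero =>
      obtain ⟨r, hr⟩ := h2 (|K| - (0 : ℕ)) (by have := le_abs_self K; omega)
      rw [hr]; exact BB_alg _ _
    | succ j ih =>
      have h3 := BB_tr hτ (|K| - (j : ℕ)) hc
      have e : |K| - (j : ℤ) = (|K| - ((j + 1 : ℕ) : ℤ)) + 1 := by push_cast; ring
      rw [map_sub] at h3
      have h4 := (BB N).sub_mem ih h3
      rw [sub_sub_cancel, e, tr_la_s hτ] at h4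
      have h5 := BB_la hs.inv h4
      rwa [la_la, inv_mul_cancel, la_one] at h5
  have := key (2 * |K|).toNat
  rwa [h1 _ (by have := le_abs_self K; have := abs_nonneg K; omega)] at this

/-- Poincare duality type statement: the coinvariant homology is `ℤ` in degree `i` and zero
above. -/
def PD (H : Subgroup G) (i : ℕ) : Prop :=
  (∀ k, i + 2 ≤ k → ∀ c ∈ ⋀[ℤ]^k (G →₀ ℤ), bd G c ∈ BB H → c ∈ EE H) ∧
  ∃ z ∈ ⋀[ℤ]^(i+1) (G →₀ ℤ), bd G z ∈ BB H ∧ (∀ m : ℤ, m • z ∈ EE H → m = 0) ∧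
    ∀ c ∈ ⋀[ℤ]^(i+1) (G →₀ ℤ), bd G c ∈ BB H → ∃ m : ℤ, c - m • z ∈ EE H

lemma BB_bot {x : EL G} (hx : x ∈ BB (⊥ : Subgroup G)) : ∃ r, x = algebraMap ℤ _ r := by
  have : BB (⊥ : Subgroup G) ≤ LinearMap.range (Algebra.linearMap ℤ (EL G)) := by
    apply Submodule.span_le.2
    rintro _ (⟨g, hg, y, rfl⟩ | ⟨r, rfl⟩)
    · rw [Subgroup.mem_bot] at hg
      subst hg
      rw [la_one, sub_self]
      exact Submodule.zero_mem _
    · exact ⟨r, rfl⟩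
  obtain ⟨r, hr⟩ := this hx
  exact ⟨r, hr.symm⟩

lemma PD_bot : PD (⊥ : Subgroup G) 0 := by
  have key : ∀ c : EL G, bd G (bs 1 * c) = c - bs 1 * bd G c := fun c => bd_bs_mul 1 c
  refine ⟨fun k hk c hc hb => ?_, bs 1, io_mem_deg _, ?_, fun m hm => ?_, fun c hc hb => ?_⟩
  · obtain ⟨r, hr⟩ := BB_bot hb
    obtain ⟨j, rfl⟩ : ∃ j, k = j + 1 + 1 := ⟨k - 2, by omega⟩
    have h0 : bd G c = 0 := by
      have h1 := pr_same (bd_mem_deg hc)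
      rw [hr, pr_ne (algebraMap_mem_deg r) (by omega)] at h1
      rw [hr, ← h1]
    have := key c
    rw [h0, mul_zero, sub_zero] at this
    rw [← this]
    exact bd_mem_EE _ _
  · rw [bs, bd_io]; exact BB_alg _ _
  · obtain ⟨b, hb, w, hw⟩ := mem_EE.1 hm
    obtain ⟨r, rfl⟩ := BB_bot hb
    have := congrArg (bd G) hw
    rw [map_add, bd_bd, bd_algebraMap, map_smul, bs, bd_io, eps_single, map_one,
      ← Algebra.algebraMap_eq_smul_one, add_zero] at this
    have h2 := congrArg (ExteriorAlgebra.algebraMapInv (R := ℤ) (M := G →₀ ℤ)) this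
    rwa [ExteriorAlgebra.algebraMap_leftInverse, map_zero] at h2
  · obtain ⟨r, hr⟩ := BB_bot hb
    refine ⟨r, ?_⟩
    have := key c
    rw [hr, ← Algebra.commutes, ← Algebra.smul_def] at this
    rw [← this]
    exact bd_mem_EE _ _

lemma PD_step {N : Subgroup G} {t : G} (ht : Nrm N t) (hf : ∀ k : ℤ, k ≠ 0 → t ^ k ∉ N)
    {i : ℕ} (hP : PD N i) : PD (N ⊔ Subgroup.zpowers (t ^ 2)) (i + 1) := by
  obtain ⟨ha, z, hz, hbz, htor, hgen⟩ := hP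
  set s := t ^ 2 with hs
  have hsN : Nrm N s := ht.pow 2
  have hfs : ∀ k : ℤ, k ≠ 0 → s ^ k ∉ N := by
    intro k hk
    have := hf (2 * k) (by omega)
    rwa [zpow_mul, zpow_ofNat] at this
  set H := N ⊔ Subgroup.zpowers s with hH
  have hNH : N ≤ H := le_sup_left
  have hsH : s ∈ H := Subgroup.mem_sup_right (Subgroup.mem_zpowers s)
  -- the class z is fixed by s
  have hsz : z - la s z ∈ EE N := by
    obtain ⟨m, hm⟩ := hgen (la t z) (act_mem_deg _ hz) (by rw [bd_act]; exact BB_la ht hbz)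
    obtain ⟨m', hm'⟩ := hgen (la t⁻¹ z) (act_mem_deg _ hz)
      (by rw [bd_act]; exact BB_la ht.inv hbz)
    have h1 := EE_la ht hm'
    rw [map_sub, la_la, mul_inv_cancel, la_one, map_smul] at h1
    have h2 := (EE N).add_mem h1 ((EE N).smul_mem m' hm)
    have e : (z - m' • la t z) + m' • (la t z - m • z) = (1 - m' * m) • z := by
      rw [smul_sub, sub_smul, one_smul, mul_smul]; abel
    rw [e] at h2
    have h3 := htor _ h2
    have h4 : m * m = 1 := by
      have : m' * m = 1 := by linarith
      have hu : IsUnit m := IsUnit.of_mul_eq_one_right _ this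
      rcases Int.isUnit_iff.1 hu with h | h <;> rw [h] <;> norm_num
    have h5 := (EE N).add_mem (EE_la ht hm) ((EE N).smul_mem m hm)
    rw [map_sub, la_la, map_smul, ← pow_two, ← hs] at h5
    have e2 : (la s z - m • la t z) + m • (la t z - m • z) = - (z - la s z) := by
      rw [smul_sub, ← mul_smul, h4, one_smul]; abel
    rw [e2] at h5
    exact neg_neg (z - la s z) ▸ (EE N).neg_mem h5
  obtain ⟨b0, hb0, w, hw, hzw⟩ :=
    mem_EE_deg (Submodule.sub_mem _ hz (act_mem_deg (fun x => s * x) hz)) hsz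
  have hbw : bd G w = z - la s z - b0 := by rw [hzw]; abel
  have lift : ∀ k, ∀ c ∈ ⋀[ℤ]^(k+1) (G →₀ ℤ), bd G c ∈ BB H →
      ∃ b ∈ BB N, ∃ u ∈ ⋀[ℤ]^k (G →₀ ℤ), bd G c = b + (u - la s u) ∧ bd G u ∈ BB N := by
    intro k c hc hb
    obtain ⟨b, hb, u, hu⟩ := BB_sup hb
    have e : bd G c = pr k b + (pr k u - la s (pr k u)) := by
      rw [← pr_act, ← map_sub, ← map_add, ← hu, pr_same (bd_mem_deg hc)]
    refine ⟨pr k b, BB_pr k hb, pr k u, pr_mem _ _, e, ?_⟩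
    apply BB_inj hsN hfs
    have e2 := congrArg (bd G) e
    rw [bd_bd, map_add, map_sub, bd_act] at e2
    have : bd G (pr k u) - la s (bd G (pr k u)) = - bd G (pr k b) := by
      rw [eq_neg_iff_add_eq_zero, e2]; abel
    rw [this]
    exact (BB N).neg_mem (BB_bd (BB_pr k hb))
  refine ⟨fun k hk c hc hb => ?_, w, hw, ?_, fun m hm => ?_, fun c hc hb => ?_⟩
  · obtain ⟨j, rfl⟩ : ∃ j, k = j + 1 := ⟨k - 1, by omega⟩
    obtain ⟨b, hb, u, hu, e, hbu⟩ := lift j c hc hb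
    obtain ⟨b1, hb1, v, hv, huv⟩ := mem_EE_deg hu (ha j (by omega) u hu hbu)
    have h1 : c - (v - la s v) ∈ EE N := by
      apply ha (j + 1) (by omega) _
        (Submodule.sub_mem _ hc (Submodule.sub_mem _ hv (act_mem_deg _ hv)))
      have : bd G (c - (v - la s v)) = b + (b1 - la s b1) := by
        rw [map_sub, map_sub, bd_act, e, huv, map_add]; abel
      rw [this]
      exact (BB N).add_mem hb ((BB N).sub_mem hb1 (BB_la hsN hb1))
    have h2 := (EE H).add_mem (EE_mono hNH h1) (BB_le_EE H (BB_sub hsH v))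
    rwa [sub_add_cancel] at h2
  · rw [hbw]
    exact (BB H).sub_mem (BB_sub hsH z) (BB_mono hNH hb0)
  · obtain ⟨x, hx, v, hv⟩ := mem_EE.1 hm
    obtain ⟨b, hb, u, rfl⟩ := BB_sup hx
    have e := congrArg (bd G) hv
    rw [map_add, bd_bd, map_smul, hbw, map_add, map_sub, bd_act] at e
    have e2 : (m • z - bd G u) - la s (m • z - bd G u) = m • b0 + bd G b := by
      rw [map_sub, map_smul]
      rw [smul_sub, smul_sub] at e
      have : m • z - la s (m • z) = m • b0 + (bd G b + (bd G u - la s (bd G u)) + 0) := by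
        rw [← e, map_smul]; abel
      rw [map_smul] at this
      calc _ = (m • z - m • la s z) - (bd G u - la s (bd G u)) := by abel
        _ = _ := by rw [this]; abel
    have h1 : m • z - bd G u ∈ BB N := by
      apply BB_inj hsN hfs
      rw [e2]
      exact (BB N).add_mem ((BB N).smul_mem m hb0) (BB_bd hb)
    apply htor
    have := (EE N).add_mem (BB_le_EE N h1) (bd_mem_EE N u)
    rwa [sub_add_cancel] at this
  · obtain ⟨b, hb, u, hu, e, hbu⟩ := lift (i + 1) c hc hb
    obtain ⟨m, hm⟩ := hgen u hu hbu
    obtain ⟨b1, hb1, v, hv, huv⟩ :=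
      mem_EE_deg (Submodule.sub_mem _ hu (Submodule.smul_mem _ m hz)) hm
    refine ⟨m, ?_⟩
    have hu' : u = m • z + b1 + bd G v := by rw [add_assoc, ← huv]; abel
    have h1 : c - m • w - (v - la s v) ∈ EE N := by
      apply ha (i + 2) le_rfl _ (Submodule.sub_mem _ (Submodule.sub_mem _ hc
        (Submodule.smul_mem _ m hw)) (Submodule.sub_mem _ hv (act_mem_deg _ hv)))
      have : bd G (c - m • w - (v - la s v)) = b + (b1 - la s b1) + m • b0 := by
        rw [map_sub, map_sub, map_sub, map_smul, bd_act, e, hbw, hu', map_add, map_add, map_smul,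
          smul_sub, smul_sub]
        abel
      rw [this]
      exact (BB N).add_mem ((BB N).add_mem hb ((BB N).sub_mem hb1 (BB_la hsN hb1)))
        ((BB N).smul_mem m hb0)
    have h2 := (EE H).add_mem (EE_mono hNH h1) (BB_le_EE H (BB_sub hsH v))
    rwa [sub_add_cancel] at h2

end HomPart

section MeanPart

variable {G : Type*} [Group G]

/-- boundedness on a subgroup -/
def BddOn (H : Subgroup G) (F : G → ℝ) : Prop := ∃ C, ∀ x ∈ H, |F x| ≤ C

lemma BddOn.mono {H K : Subgroup G} (h : H ≤ K) {F : G → ℝ} (hF : BddOn K F) : BddOn H F := by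
  obtain ⟨C, hC⟩ := hF
  exact ⟨C, fun x hx => hC x (h hx)⟩

lemma BddOn.shift {H : Subgroup G} {F : G → ℝ} (hF : BddOn H F) {h : G} (hh : h ∈ H) :
    BddOn H (fun x => F (x * h)) := by
  obtain ⟨C, hC⟩ := hF
  exact ⟨C, fun x hx => hC _ (H.mul_mem hx hh)⟩

lemma BddOn.add {H : Subgroup G} {F F' : G → ℝ} (hF : BddOn H F) (hF' : BddOn H F') :
    BddOn H (fun x => F x + F' x) := by
  obtain ⟨C, hC⟩ := hF
  obtain ⟨C', hC'⟩ := hF'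
  exact ⟨C + C', fun x hx => (abs_add_le _ _).trans (add_le_add (hC x hx) (hC' x hx))⟩

/-- A right invariant mean on bounded functions on the subgroup `H`. -/
structure IsMean (H : Subgroup G) (m : (G → ℝ) → ℝ) : Prop where
  add : ∀ F F', BddOn H F → BddOn H F' → m (fun x => F x + F' x) = m F + m F'
  bound : ∀ F C, (∀ x ∈ H, |F x| ≤ C) → |m F| ≤ C
  const : ∀ F c, (∀ x ∈ H, F x = c) → m F = c
  inv : ∀ h ∈ H, ∀ F, BddOn H F → m (fun x => F (x * h)) = m F

lemma isMean_bot : IsMean (⊥ : Subgroup G) (fun F => F 1) where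
  add F F' _ _ := rfl
  bound F C h := h 1 (Subgroup.one_mem _)
  const F c h := h 1 (Subgroup.one_mem _)
  inv h hh F _ := by rw [Subgroup.mem_bot] at hh; simp [hh]

open Filter Topology in
lemma exists_ulim : ∃ L : (ℕ → ℝ) → ℝ,
    (∀ a b, (∃ C, ∀ n, |a n| ≤ C) → (∃ C, ∀ n, |b n| ≤ C) → L (fun n => a n + b n) = L a + L b) ∧
    (∀ a C, (∀ n, |a n| ≤ C) → |L a| ≤ C) ∧
    (∀ a c, Tendsto a atTop (𝓝 c) → L a = c) := by
  let U : Filter ℕ := (hyperfilter ℕ : Filter ℕ)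
  have hU : U ≤ atTop := Nat.hyperfilter_le_atTop
  have key : ∀ a : ℕ → ℝ, (∃ C, ∀ n, |a n| ≤ C) → Tendsto a U (𝓝 (limUnder U a)) := by
    rintro a ⟨C, hC⟩
    have hc : IsCompact (Set.Icc (-C) C) := isCompact_Icc
    obtain ⟨l, _, hl⟩ := hc.ultrafilter_le_nhds ((hyperfilter ℕ).map a) (by
      rw [le_principal_iff]
      have : a ⁻¹' Set.Icc (-C) C = Set.univ :=
        Set.eq_univ_of_forall fun n => abs_le.1 (hC n)
      change Set.Icc (-C) C ∈ Filter.map a (hyperfilter ℕ : Filter ℕ)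
      rw [Filter.mem_map, this]
      exact Filter.univ_mem)
    exact tendsto_nhds_limUnder ⟨l, hl⟩
  refine ⟨fun a => limUnder U a, ?_, ?_, ?_⟩
  · intro a b ha hb
    exact ((key a ha).add (key b hb)).limUnder_eq
  · intro a C hC
    have := key a ⟨C, hC⟩
    exact le_of_tendsto this.abs (Eventually.of_forall hC)
  · intro a c hc
    exact (hc.mono_left hU).limUnder_eq

lemma IsMean.step {N : Subgroup G} {m : (G → ℝ) → ℝ} (hm : IsMean N m) {s : G} (hs : Nrm N s) :
    ∃ m', IsMean (N ⊔ Subgroup.zpowers s) m' := by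
  obtain ⟨L, Ladd, Lbound, Llim⟩ := exists_ulim
  set H := N ⊔ Subgroup.zpowers s with hH
  have hNH : N ≤ H := le_sup_left
  have hsH : ∀ j : ℕ, s ^ j ∈ H := fun j =>
    H.pow_mem (Subgroup.mem_sup_right (Subgroup.mem_zpowers s)) j
  let A : (G → ℝ) → ℕ → ℝ := fun F k =>
    (∑ j ∈ Finset.range (k + 1), m (fun x => F (x * s ^ j))) / (k + 1)
  have Abound : ∀ F C, (∀ x ∈ H, |F x| ≤ C) → ∀ k, |A F k| ≤ C := by
    intro F C hC k
    have hk : (0 : ℝ) < k + 1 := by positivity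
    simp only [A]
    rw [abs_div, abs_of_pos hk, div_le_iff₀ hk]
    refine (Finset.abs_sum_le_sum_abs _ _).trans ?_
    refine (Finset.sum_le_card_nsmul _ _ C ?_).trans ?_
    · intro j _
      exact hm.bound _ _ fun x hx => hC _ (H.mul_mem (hNH hx) (hsH j))
    · simp [mul_comm]
  have Ab : ∀ F, BddOn H F → ∃ C, ∀ k, |A F k| ≤ C := by
    rintro F ⟨C, hC⟩
    exact ⟨C, Abound F C hC⟩
  have hadd : ∀ F F', BddOn H F → BddOn H F' →
      L (A (fun x => F x + F' x)) = L (A F) + L (A F') := by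
    intro F F' hF hF'
    rw [← Ladd _ _ (Ab F hF) (Ab F' hF')]
    congr 1
    funext k
    simp only [A]
    rw [← add_div, ← Finset.sum_add_distrib]
    congr 1
    refine Finset.sum_congr rfl fun j _ => ?_
    exact hm.add _ _ ((hF.shift (hsH j)).mono hNH) ((hF'.shift (hsH j)).mono hNH)
  refine ⟨fun F => L (A F), hadd, fun F C hC => Lbound _ _ (Abound F C hC), ?_, ?_⟩
  · intro F c hc
    have : A F = fun _ => c := by
      funext k
      simp only [A]
      have : ∀ j ∈ Finset.range (k + 1), m (fun x => F (x * s ^ j)) = c := fun j _ =>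
        hm.const _ _ fun x hx => hc _ (H.mul_mem (hNH hx) (hsH j))
      rw [Finset.sum_congr rfl this]
      have hk : ((k : ℝ) + 1) ≠ 0 := by positivity
      simp
      field_simp
    rw [this]
    exact Llim _ _ tendsto_const_nhds
  · have hN : ∀ n ∈ N, ∀ F, BddOn H F → L (A (fun x => F (x * n))) = L (A F) := by
      intro n hn F hF
      congr 1
      funext k
      simp only [A]
      congr 1
      refine Finset.sum_congr rfl fun j _ => ?_
      have := hm.inv _ ((hs.pow j).1 n hn) _ ((hF.shift (hsH j)).mono hNH)
      rw [← this]
      congr 1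
      funext x
      congr 1
      group
    have hS : ∀ F, BddOn H F → L (A (fun x => F (x * s))) = L (A F) := by
      intro F hF
      obtain ⟨C, hC⟩ := hF
      have hFs := BddOn.shift (H := H) ⟨C, hC⟩ (pow_one s ▸ hsH 1)
      have e : A (fun x => F (x * s)) = fun k => A F k +
          (m (fun x => F (x * s ^ (k + 1))) - m (fun x => F (x * s ^ 0))) / (k + 1) := by
        funext k
        simp only [A]
        rw [← add_div]
        congr 1
        have h1 := Finset.sum_range_succ (fun j => m (fun x => F (x * s ^ j))) (k + 1)
        rw [Finset.sum_range_succ'] at h1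
        have h2 : ∀ j, m (fun x => F (x * s ^ j * s)) = m (fun x => F (x * s ^ (j + 1))) := by
          intro j
          congr 1
          funext x
          rw [pow_succ, mul_assoc]
        simp only [h2]
        linarith
      have hb : ∀ k : ℕ, |m (fun x => F (x * s ^ k))| ≤ C := fun k =>
        hm.bound _ _ fun x hx => hC _ (H.mul_mem (hNH hx) (hsH k))
      have hC0 : 0 ≤ C := (abs_nonneg _).trans (hb 0)
      have hb2 : ∀ k : ℕ, |(m (fun x => F (x * s ^ (k + 1))) - m (fun x => F (x * s ^ 0))) /
          (k + 1)| ≤ (2 * C) * (1 / ((k : ℝ) + 1)) := by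
        intro k
        have hk : (0 : ℝ) < k + 1 := by positivity
        rw [abs_div, abs_of_pos hk, div_eq_mul_one_div]
        refine mul_le_mul_of_nonneg_right ?_ (by positivity)
        have := abs_sub (m (fun x => F (x * s ^ (k + 1)))) (m (fun x => F (x * s ^ 0)))
        linarith [hb (k + 1), hb 0]
      have hlim : Filter.Tendsto (fun k : ℕ => (m (fun x => F (x * s ^ (k + 1))) -
          m (fun x => F (x * s ^ 0))) / ((k : ℝ) + 1)) Filter.atTop (nhds 0) := by
        apply squeeze_zero_norm hb2
        have := (tendsto_one_div_add_atTop_nhds_zero_nat (𝕜 := ℝ)).const_mul (2 * C)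
        rwa [mul_zero] at this
      rw [e, Ladd _ _ ⟨C, Abound F C hC⟩, Llim _ _ hlim, add_zero]
      refine ⟨2 * C, fun k => (hb2 k).trans ?_⟩
      have : (1 / ((k : ℝ) + 1)) ≤ 1 := by
        rw [div_le_one (by positivity)]
        have : (0 : ℝ) ≤ k := by positivity
        linarith
      nlinarith
    let S : Subgroup G :=
      { carrier := {h | h ∈ H ∧ ∀ F, BddOn H F → L (A (fun x => F (x * h))) = L (A F)}
        one_mem' := ⟨H.one_mem, fun F _ => by simp⟩
        mul_mem' := by
          rintro a b ⟨ha, ha'⟩ ⟨hb, hb'⟩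
          refine ⟨H.mul_mem ha hb, fun F hF => ?_⟩
          rw [← hb' F hF, ← ha' _ (hF.shift hb)]
          simp only [mul_assoc]
        inv_mem' := by
          rintro a ⟨ha, ha'⟩
          refine ⟨H.inv_mem ha, fun F hF => ?_⟩
          rw [← ha' _ (hF.shift (H.inv_mem ha))]
          simp }
    have hle : H ≤ S := by
      refine sup_le (fun n hn => ⟨hNH hn, hN n hn⟩) ?_
      rw [Subgroup.zpowers_le]
      exact ⟨pow_one s ▸ hsH 1, hS⟩
    intro h hh F hF
    exact (hle hh).2 F hF

end MeanPart

section KPart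

variable {G : Type*}

lemma bs_anti (a b : G) : (bs a * bs b : EL G) = - (bs b * bs a) := by
  have h := io_sq (Finsupp.single a (1 : ℤ) + Finsupp.single b (1 : ℤ))
  rw [map_add] at h
  change (bs a + bs b) * (bs a + bs b) = 0 at h
  have ha : (bs a * bs a : EL G) = 0 := io_sq _
  have hb : (bs b * bs b : EL G) = 0 := io_sq _
  rw [add_mul, mul_add, mul_add, ha, hb, zero_add, add_zero] at h
  exact eq_neg_of_add_eq_zero_left h

/-- quadratic part -/
noncomputable def kk (p : G → G) : (G →₀ ℤ) →ₗ[ℤ] EL G :=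
  Finsupp.linearCombination ℤ (fun x => bs x * bs (p x))

lemma io_kk (p : G → G) (v w : G →₀ ℤ) : io v * kk p w = kk p w * io v := by
  induction v using Finsupp.induction_linear with
  | zero => simp
  | add v v' h h' => rw [map_add, add_mul, mul_add, h, h']
  | single x n =>
    have e : io (Finsupp.single x n) = n • (bs x : EL G) := by
      rw [bs, ← map_smul, Finsupp.smul_single, smul_eq_mul, mul_one]
    rw [e, smul_mul_assoc, mul_smul_comm]
    congr 1
    induction w using Finsupp.induction_linear with
    | zero => simp
    | add v v' h h' => rw [map_add, add_mul, mul_add, h, h']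
    | single y m =>
      rw [kk, Finsupp.linearCombination_single, smul_mul_assoc, mul_smul_comm]
      congr 1
      rw [← mul_assoc, bs_anti x y, neg_mul, mul_assoc, bs_anti x (p y), mul_neg, neg_neg,
        mul_assoc]

/-- fold function for the odd derivation -/
noncomputable def kfun (p : G → G) : (G →₀ ℤ) →ₗ[ℤ] EL G × EL G →ₗ[ℤ] EL G :=
  LinearMap.mk₂ ℤ (fun v yz => kk p v * yz.1 - io v * yz.2)
    (by intro v v' yz; simp only [map_add, add_mul]; abel)
    (by intro c v yz; rw [map_smul, map_smul, smul_mul_assoc, smul_mul_assoc, smul_sub])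
    (by intro v yz yz'; simp only [Prod.fst_add, Prod.snd_add, mul_add]; abel)
    (by
      intro c v yz
      rw [Prod.smul_fst, Prod.smul_snd, mul_smul_comm, mul_smul_comm, smul_sub])

lemma kfun_apply (p : G → G) (v : G →₀ ℤ) (yz : EL G × EL G) :
    kfun p v yz = kk p v * yz.1 - io v * yz.2 := rfl

lemma kfun_sq (p : G → G) (v : G →₀ ℤ) (x fx : EL G) :
    kfun p v (CliffordAlgebra.ι (0 : QuadraticForm ℤ (G →₀ ℤ)) v * x, kfun p v (x, fx)) =
      (0 : QuadraticForm ℤ (G →₀ ℤ)) v • fx := by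
  change kfun p v (io v * x, kfun p v (x, fx)) = _
  rw [kfun_apply, kfun_apply]
  simp only
  rw [mul_sub, ← mul_assoc, ← mul_assoc, ← mul_assoc, io_sq, io_kk]
  simp

/-- The odd derivation. -/
noncomputable def KK (p : G → G) : EL G →ₗ[ℤ] EL G :=
  CliffordAlgebra.foldr' (0 : QuadraticForm ℤ (G →₀ ℤ)) (kfun p) (kfun_sq p) 0

lemma KK_one (p : G → G) : KK p 1 = 0 := by
  have := CliffordAlgebra.foldr'_algebraMap (0 : QuadraticForm ℤ (G →₀ ℤ)) (kfun p) (kfun_sq p) 0 1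
  rw [map_one, smul_zero] at this
  exact this

lemma KK_bs_mul (p : G → G) (x : G) (y : EL G) :
    KK p (bs x * y) = bs x * bs (p x) * y - bs x * KK p y := by
  have := CliffordAlgebra.foldr'_ι_mul (0 : QuadraticForm ℤ (G →₀ ℤ)) (kfun p) (kfun_sq p) 0
    (Finsupp.single x (1 : ℤ)) y
  change KK p (bs x * y) = kfun p _ (y, KK p y) at this
  rw [this, kfun_apply, kk, Finsupp.linearCombination_single, one_smul]
  rfl

/-- The even derivation `∂K + K∂`. -/
noncomputable def TT (p : G → G) : EL G →ₗ[ℤ] EL G := bd G ∘ₗ KK p + KK p ∘ₗ bd G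

lemma TT_apply (p : G → G) (y : EL G) : TT p y = bd G (KK p y) + KK p (bd G y) := rfl

lemma TT_one (p : G → G) : TT p 1 = 0 := by
  have := bd_algebraMap (G := G) 1
  rw [map_one] at this
  rw [TT_apply, KK_one, this, map_zero, map_zero, add_zero]

lemma TT_bd (p : G → G) (y : EL G) : TT p (bd G y) = bd G (TT p y) := by
  rw [TT_apply, TT_apply, bd_bd, map_add, bd_bd, map_zero, zero_add, add_zero]

lemma TT_bs_mul (p : G → G) (x : G) (y : EL G) :
    TT p (bs x * y) = (bs (p x) - bs x) * y + bs x * TT p y := by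
  rw [TT_apply, TT_apply, KK_bs_mul, map_sub, mul_assoc, bd_bs_mul, bd_bs_mul, bd_bs_mul,
    bd_bs_mul, map_sub, KK_bs_mul]
  noncomm_ring

lemma TT_pu {p : G → G} (hp : ∀ x, p (p x) = p x) (x : G) (y : EL G) :
    TT p (bs (p x) * y) = bs (p x) * TT p y := by
  rw [TT_bs_mul, hp, sub_self, zero_mul, zero_add]

lemma TT_v {p : G → G} (hp : ∀ x, p (p x) = p x) (x : G) (y : EL G) :
    TT p ((bs x - bs (p x)) * y) = (bs x - bs (p x)) * (TT p y - y) := by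
  rw [sub_mul, map_sub, TT_pu hp, TT_bs_mul]
  noncomm_ring

lemma TT_act {p : G → G} (hp : ∀ x, p (p x) = p x) (y : EL G) : TT p (act p y) = 0 := by
  induction y using EL_induction with
  | hadd x y hx hy => rw [map_add, map_add, hx, hy, add_zero]
  | hsmul n x hx => rw [map_smul, map_smul, hx, smul_zero]
  | hone => rw [map_one, TT_one]
  | hmul x y hy => rw [map_mul, act_bs, TT_pu hp, hy, mul_zero]

/-- `∏_{a=1}^n (T + a)` -/
noncomputable def PP (p : G → G) : ℕ → EL G → EL G
  | 0, y => y
  | n + 1, y => TT p (PP p n y) + ((n + 1 : ℕ) : ℤ) • PP p n y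

lemma PP_add (p : G → G) (n : ℕ) (x y : EL G) : PP p n (x + y) = PP p n x + PP p n y := by
  induction n with
  | zero => rfl
  | succ n ih => rw [PP, PP, PP, ih, map_add, smul_add]; abel

lemma PP_zero (p : G → G) (n : ℕ) : PP p n 0 = 0 := by
  induction n with
  | zero => rfl
  | succ n ih => rw [PP, ih, map_zero, smul_zero, add_zero]

lemma PP_smul (p : G → G) (n : ℕ) (c : ℤ) (x : EL G) : PP p n (c • x) = c • PP p n x := by
  induction n with
  | zero => rfl
  | succ n ih => rw [PP, PP, ih, map_smul, smul_add, smul_comm c]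

lemma PP_TT (p : G → G) (n : ℕ) (x : EL G) : PP p n (TT p x) = TT p (PP p n x) := by
  induction n with
  | zero => rfl
  | succ n ih => rw [PP, PP, ih, map_add, map_smul]

lemma PP_pu {p : G → G} (hp : ∀ x, p (p x) = p x) (n : ℕ) (x : G) (y : EL G) :
    PP p n (bs (p x) * y) = bs (p x) * PP p n y := by
  induction n with
  | zero => rfl
  | succ n ih => rw [PP, PP, ih, TT_pu hp, mul_add, mul_smul_comm]

lemma PP_v {p : G → G} (hp : ∀ x, p (p x) = p x) (n : ℕ) (x : G) (y : EL G) :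
    PP p (n + 1) ((bs x - bs (p x)) * y) = (bs x - bs (p x)) * PP p n (TT p y) := by
  induction n with
  | zero =>
    rw [PP, PP, PP, TT_v hp, mul_sub]
    simp
  | succ n ih =>
    rw [PP, ih, TT_v hp, PP]
    push_cast
    rw [mul_add, mul_sub, mul_smul_comm, add_smul _ (1 : ℤ), one_smul]
    abel

lemma PP_deg {p : G → G} (hp : ∀ x, p (p x) = p x) (n : ℕ) (y : EL G)
    (hy : y ∈ ⋀[ℤ]^n (G →₀ ℤ)) : PP p n y = (n.factorial : ℤ) • act p y := by
  refine EL_deg_induction (P := fun n y => PP p n y = (n.factorial : ℤ) • act p y)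
    ?_ ?_ ?_ ?_ ?_ n y hy
  · intro k; rw [PP_zero, map_zero, smul_zero]
  · intro k x y hx hy; rw [PP_add, hx, hy, map_add, smul_add]
  · intro k c x hx; rw [PP_smul, hx, map_smul, smul_comm]
  · rw [PP, map_one]; simp
  · intro k x y _ ih
    have e : bs x * y = bs (p x) * y + (bs x - bs (p x)) * y := by noncomm_ring
    rw [e, PP_add, PP_v hp, PP_TT, ih, PP_pu hp, PP, ih, map_add, map_mul, map_mul, map_sub,
      act_bs, act_bs, hp, sub_self, zero_mul, add_zero, map_smul, TT_act hp, smul_zero, mul_zero,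
      add_zero, zero_add, ← mul_smul, mul_smul_comm]
    congr 1

end KPart

section FTPart

variable {G : Type*} [Group G]

/-- Operators with finite orbit of conjugates on every element. -/
def FT (Q : EL G → EL G) : Prop := ∀ b : EL G, (Set.range fun g : G => la g⁻¹ (Q (la g b))).Finite

lemma la_inv_la (g : G) (y : EL G) : la g⁻¹ (la g y) = y := by
  rw [la_la, inv_mul_cancel, la_one]

lemma la_la_inv (g : G) (y : EL G) : la g (la g⁻¹ y) = y := by
  rw [la_la, mul_inv_cancel, la_one]

lemma FT.comp {Q Q' : EL G → EL G} (h : FT Q) (h' : FT Q') : FT (fun y => Q (Q' y)) := by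
  intro b
  refine ((h' b).biUnion fun v _ => h v).subset ?_
  rintro _ ⟨g, rfl⟩
  simp only [Set.mem_iUnion]
  refine ⟨_, ⟨g, rfl⟩, g, ?_⟩
  simp only [la_la_inv]

lemma FT.add {Q Q' : EL G → EL G} (h : FT Q) (h' : FT Q') : FT (fun y => Q y + Q' y) := by
  intro b
  refine (Set.Finite.image2 (fun x y => x + y) (h b) (h' b)).subset ?_
  rintro _ ⟨g, rfl⟩
  exact ⟨_, ⟨g, rfl⟩, _, ⟨g, rfl⟩, by simp only [map_add]⟩

lemma FT.smul_id (c : ℤ) : FT (fun y : EL G => c • y) := by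
  intro b
  refine (Set.finite_singleton (c • b)).subset ?_
  rintro _ ⟨g, rfl⟩
  simp only [map_smul, la_inv_la, Set.mem_singleton_iff]

lemma FT.bd : FT (bd G) := by
  intro b
  refine (Set.finite_singleton (_root_.bd G b)).subset ?_
  rintro _ ⟨g, rfl⟩
  simp only [bd_act, la_inv_la, Set.mem_singleton_iff]

lemma FT.KK [MetricSpace G] (hinv : ∀ g x y : G, dist (g * x) (g * y) = dist x y)
    (hproper : ∀ (x : G) (r : ℝ), {y : G | dist x y ≤ r}.Finite) {p : G → G} {R : ℝ}
    (hR : ∀ x, dist x (p x) ≤ R) : FT (KK p) := by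
  intro b
  induction b using EL_induction with
  | hadd x y hx hy =>
    refine (Set.Finite.image2 (fun x y => x + y) hx hy).subset ?_
    rintro _ ⟨g, rfl⟩
    exact ⟨_, ⟨g, rfl⟩, _, ⟨g, rfl⟩, by simp only [map_add]⟩
  | hsmul n x hx =>
    refine (hx.image (fun y => n • y)).subset ?_
    rintro _ ⟨g, rfl⟩
    exact ⟨_, ⟨g, rfl⟩, by simp only [map_smul]⟩
  | hone =>
    refine (Set.finite_singleton 0).subset ?_
    rintro _ ⟨g, rfl⟩
    simp only [map_one, KK_one, map_zero, Set.mem_singleton_iff]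
  | hmul x y hy =>
    refine (Set.Finite.image2 (fun (q : G) z => bs x * bs q * y - bs x * z) (hproper x R) hy).subset
      ?_
    rintro _ ⟨g, rfl⟩
    refine ⟨g⁻¹ * p (g * x), ?_, _, ⟨g, rfl⟩, ?_⟩
    · have := hR (g * x)
      rw [← hinv g⁻¹] at this
      simpa using this
    · simp only [map_mul, act_bs, KK_bs_mul, map_sub, la_inv_la]
      rw [inv_mul_cancel_left]

/-- Factorization of the product operator. -/
lemma PP_factor {p : G → G} (hK : FT (KK p)) (n : ℕ) : ∃ S : EL G →ₗ[ℤ] EL G,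
    (∀ y, PP p n y = (n.factorial : ℤ) • y + TT p (S y)) ∧ FT S ∧
    (∀ y, S (bd G y) = bd G (S y)) ∧ ∃ r : ℤ, S 1 = r • 1 := by
  have hT : FT (TT p) := (FT.bd.comp hK).add (hK.comp FT.bd)
  induction n with
  | zero =>
    refine ⟨0, fun y => ?_, ?_, fun y => by simp, 0, by simp⟩
    · rw [PP]; simp
    · have h := FT.smul_id (G := G) 0
      simp only [zero_smul] at h
      exact h
  | succ n ih =>
    obtain ⟨S, h1, h2, h3, r, h4⟩ := ih
    refine ⟨(n.factorial : ℤ) • LinearMap.id + (TT p ∘ₗ S + ((n + 1 : ℕ) : ℤ) • S), fun y => ?_,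
      ?_, fun y => ?_, n.factorial + (n + 1 : ℕ) * r, ?_⟩
    · simp only [LinearMap.add_apply, LinearMap.smul_apply, LinearMap.comp_apply,
        LinearMap.id_apply]
      rw [PP, h1, map_add, map_smul, map_add, map_smul, map_add, map_smul, smul_add, ← mul_smul,
        Nat.factorial_succ]
      push_cast
      abel
    · exact (FT.smul_id _).add ((hT.comp h2).add ((FT.smul_id _).comp h2))
    · simp only [LinearMap.add_apply, LinearMap.smul_apply, LinearMap.comp_apply,
        LinearMap.id_apply]
      rw [h3, TT_bd, map_add, map_add, map_smul, map_smul]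
    · simp only [LinearMap.add_apply, LinearMap.smul_apply, LinearMap.comp_apply,
        LinearMap.id_apply]
      rw [h4, map_smul, TT_one, smul_zero, zero_add, add_smul, mul_smul]

end FTPart

section LowerPart

variable {G : Type*}

lemma bs_sq (a : G) : (bs a * bs a : EL G) = 0 := io_sq _

lemma bs_mul_prod_of_mem (a : G) (l : List G) (h : a ∈ l) : bs a * (l.map bs).prod = (0 : EL G) := by
  induction l with
  | nil => simp at h
  | cons b l ih =>
    rw [List.map_cons, List.prod_cons]
    rcases List.mem_cons.1 h with rfl | h
    · rw [← mul_assoc, bs_sq, zero_mul]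
    · rw [← mul_assoc, bs_anti, neg_mul, mul_assoc, ih h, mul_zero, neg_zero]

lemma prod_bs_of_not_nodup (l : List G) (h : ¬ l.Nodup) : (l.map bs).prod = (0 : EL G) := by
  induction l with
  | nil => simp at h
  | cons b l ih =>
    rw [List.map_cons, List.prod_cons]
    rw [List.nodup_cons, not_and_or, not_not] at h
    rcases h with h | h
    · exact bs_mul_prod_of_mem b l h
    · rw [ih h, mul_zero]

lemma mem_span_prod (k : ℕ) (z : EL G) (hz : z ∈ ⋀[ℤ]^k (G →₀ ℤ)) :
    z ∈ Submodule.span ℤ {y : EL G | ∃ l : List G, l.length = k ∧ y = (l.map bs).prod} := by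
  refine EL_deg_induction (P := fun k z => z ∈ Submodule.span ℤ
    {y : EL G | ∃ l : List G, l.length = k ∧ y = (l.map bs).prod}) ?_ ?_ ?_ ?_ ?_ k z hz
  · intro k; exact Submodule.zero_mem _
  · intro k x y hx hy; exact Submodule.add_mem _ hx hy
  · intro k n x hx; exact Submodule.smul_mem _ _ hx
  · exact Submodule.subset_span ⟨[], rfl, by simp⟩
  · intro k x y hy0 hy
    clear hy0
    induction hy using Submodule.span_induction with
    | mem y h =>
      obtain ⟨l, hl, rfl⟩ := h
      exact Submodule.subset_span ⟨x :: l, by simp [hl], by simp⟩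
    | zero => rw [mul_zero]; exact Submodule.zero_mem _
    | add y y' _ _ h h' => rw [mul_add]; exact Submodule.add_mem _ h h'
    | smul c y _ h => rw [mul_smul_comm]; exact Submodule.smul_mem _ _ h

lemma act_prod (f : G → G) (l : List G) : act f (l.map bs).prod = ((l.map f).map bs).prod := by
  induction l with
  | nil => simp
  | cons b l ih => simp only [List.map_cons, List.prod_cons, map_mul, act_bs, ih]

lemma list_bdd [MetricSpace G] (l : List G) : ∃ d : ℝ, 0 < d ∧ ∀ x ∈ l, ∀ y ∈ l, dist x y ≤ d := by
  have hb : Bornology.IsBounded {x | x ∈ l} := (List.finite_toSet l).isBounded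
  obtain ⟨C, hC⟩ := Metric.isBounded_iff.1 hb
  exact ⟨max C 1, by positivity, fun x hx y hy => (hC hx hy).trans (le_max_left _ _)⟩

lemma act_vanish [MetricSpace G] (k : ℕ) (z : EL G) (hz : z ∈ ⋀[ℤ]^k (G →₀ ℤ)) :
    ∃ d : ℝ, 0 < d ∧ ∀ f : G → G, (∀ l : List G, l.length = k →
      (∀ x ∈ l, ∀ y ∈ l, dist x y ≤ d) → ¬ (l.map f).Nodup) → act f z = 0 := by
  have := mem_span_prod k z hz
  clear hz
  induction this using Submodule.span_induction with
  | mem y h =>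
    obtain ⟨l, hl, rfl⟩ := h
    obtain ⟨d, hd, h⟩ := list_bdd l
    refine ⟨d, hd, fun f hf => ?_⟩
    rw [act_prod, prod_bs_of_not_nodup _ (hf l hl h)]
  | zero => exact ⟨1, one_pos, fun f _ => map_zero _⟩
  | add y y' _ _ h h' =>
    obtain ⟨d, hd, h⟩ := h
    obtain ⟨d', hd', h'⟩ := h'
    refine ⟨max d d', lt_max_of_lt_left hd, fun f hf => ?_⟩
    rw [map_add, h f fun l hl hl' => hf l hl fun x hx y hy =>
      (hl' x hx y hy).trans (le_max_left _ _), h' f fun l hl hl' => hf l hl fun x hx y hy =>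
      (hl' x hx y hy).trans (le_max_right _ _), add_zero]
  | smul c y _ h =>
    obtain ⟨d, hd, h⟩ := h
    exact ⟨d, hd, fun f hf => by rw [map_smul, h f hf, smul_zero]⟩

/-- The retraction onto a coarse nerve. -/
lemma exists_retract [MetricSpace G] {n : ℕ} (h : SA (Set.univ : Set G) n) {d : ℝ} (hd : 0 < d) :
    ∃ (p : G → G) (R : ℝ) (c : G → Fin (n + 1)), (∀ x, p (p x) = p x) ∧ (∀ x, dist x (p x) ≤ R) ∧
      ∀ x y, dist x y ≤ d → c x = c y → p x = p y := by
  obtain ⟨R, hR, U, hU, hc⟩ := h d hd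
  have : ∀ x, ∃ i, x ∈ U i := fun x => by simpa using hc (Set.mem_univ x)
  choose c hc using this
  let r : G → G → Prop := fun x y => Relation.ReflTransGen (fun x y => c x = c y ∧ dist x y ≤ d) x y
  have hsymm : ∀ x y, r x y → r y x := by
    intro x y h
    induction h with
    | refl => exact .refl
    | tail _ h ih => exact Relation.ReflTransGen.head ⟨h.1.symm, by rw [dist_comm]; exact h.2⟩ ih
  let s : Setoid G := ⟨r, fun x => .refl, fun {x y} h => hsymm x y h, fun h h' => h.trans h'⟩
  let p : G → G := fun x => (Quotient.mk s x).out
  have hp : ∀ x, r x (p x) := fun x => hsymm _ _ (Quotient.exact (s := s) (Quotient.out_eq _))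
  have hp' : ∀ x y, r x y → p x = p y := fun x y h => by
    have : Quotient.mk s x = Quotient.mk s y := Quotient.sound h
    simp only [p, this]
  refine ⟨p, R, c, fun x => (hp' _ _ (hp x)).symm, fun x => ?_, fun x y h h' =>
    hp' _ _ (.single ⟨h', h⟩)⟩
  have key : ∀ y, r x y → c x = c y ∧ Relation.ReflTransGen (ChainStep d (U (c x))) x y := by
    intro y h
    induction h with
    | refl => exact ⟨rfl, .refl⟩
    | tail _ h ih =>
      refine ⟨ih.1.trans h.1, ih.2.tail ⟨?_, ?_, h.2⟩⟩
      · rw [ih.1]; exact hc _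
      · rw [ih.1, h.1]; exact hc _
  exact hU _ _ _ (key _ (hp x)).2

lemma exists_functional (E : Submodule ℤ (EL G)) (z : EL G) (hz : ∀ m : ℤ, m • z ∈ E → m = 0) :
    ∃ φ : EL G →+ ℝ, (∀ y ∈ E, φ y = 0) ∧ φ z = 1 := by
  let q : EL G →+ (EL G ⧸ E) := E.mkQ.toAddMonoidHom
  let i : ℤ →+ (EL G ⧸ E) := (zmultiplesHom _) (q z)
  have hi : Function.Injective i := by
    rw [injective_iff_map_eq_zero]
    intro m hm
    apply hz
    have : E.mkQ (m • z) = 0 := by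
      rw [map_smul]; exact hm
    simpa using this
  obtain ⟨ψ, hψ⟩ := Module.Baer.extension_property_addMonoidHom
    (Module.Baer.of_divisible ℝ) i hi ((zmultiplesHom ℝ) 1)
  refine ⟨ψ.comp q, fun y hy => ?_, ?_⟩
  · have : q y = 0 := by
      change E.mkQ y = 0
      simpa using hy
    rw [AddMonoidHom.comp_apply, this, map_zero]
  · have := DFunLike.congr_fun hψ 1
    simpa [i] using this

variable [Group G]

lemma IsMean.neg {H : Subgroup G} {m : (G → ℝ) → ℝ} (hm : IsMean H m) {F : G → ℝ}
    (hF : BddOn H F) : m (fun x => - F x) = - m F := by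
  have h' : BddOn H (fun x => - F x) := by
    obtain ⟨C, hC⟩ := hF
    exact ⟨C, fun x hx => by rw [abs_neg]; exact hC x hx⟩
  have h1 := hm.add F (fun x => - F x) hF h'
  have h2 := hm.const (fun x => F x + - F x) 0 (fun x _ => by ring)
  linarith

theorem lower_bound [MetricSpace G] (hinv : ∀ g x y : G, dist (g * x) (g * y) = dist x y)
    (hproper : ∀ (x : G) (r : ℝ), {y : G | dist x y ≤ r}.Finite) {H : Subgroup G} {n : ℕ}
    {m : (G → ℝ) → ℝ} (hm : IsMean H m) (hP : PD H (n + 1)) (h : SA (Set.univ : Set G) n) :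
    False := by
  obtain ⟨-, z, hz, hbz, hzE, -⟩ := hP
  obtain ⟨φ, hφE, hφz⟩ := exists_functional (EE H) z hzE
  obtain ⟨d, hd, hv⟩ := act_vanish _ z hz
  obtain ⟨p, R, c, hp, hR, hpc⟩ := exists_retract h hd
  have hK := FT.KK hinv hproper hR
  obtain ⟨S, hS, hSF, hSb, r, hr⟩ := PP_factor hK (n + 1 + 1)
  have hφla : ∀ g ∈ H, ∀ y, φ (la g y) = φ y := by
    intro g hg y
    have := hφE _ (BB_le_EE H (BB_sub hg y))
    rw [map_sub] at this
    linarith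
  have hact : ∀ g, act p (la g z) = 0 := by
    intro g
    rw [la, act_act]
    apply hv
    intro l hl hld hnd
    have h1 := List.inj_on_of_nodup_map hnd
    have h2 : l.Nodup := List.Nodup.of_map _ hnd
    have h3 : (l.map (fun x => c (g * x))).Nodup := by
      refine List.Nodup.map_on ?_ h2
      intro x hx y hy hxy
      apply h1 hx hy
      exact hpc _ _ (by rw [hinv]; exact hld x hx y hy) hxy
    have h4 := h3.length_le_card
    rw [List.length_map, hl, Fintype.card_fin] at h4
    omega
  let F : EL G → G → ℝ := fun b g => φ (KK p (S (la g b)))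
  have hF : ∀ b, BddOn H (F b) := by
    intro b
    have hfin := ((hK.comp hSF) b).image (fun y => |φ y|)
    obtain ⟨C, hC⟩ := hfin.bddAbove
    refine ⟨C, fun g hg => ?_⟩
    have : F b g = φ (la g⁻¹ (KK p (S (la g b)))) := (hφla _ (H.inv_mem hg) _).symm
    rw [this]
    exact hC ⟨_, ⟨g, rfl⟩, rfl⟩
  have hFadd : ∀ b b' g, F (b + b') g = F b g + F b' g := by
    intro b b' g
    simp only [F, map_add]
  have hFneg : ∀ b g, F (-b) g = - F b g := by
    intro b g
    simp only [F, map_neg]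
  have hmadd : ∀ b b', m (F (b + b')) = m (F b) + m (F b') := by
    intro b b'
    rw [← hm.add _ _ (hF b) (hF b')]
    congr 1
    funext g
    exact hFadd _ _ _
  have hmneg : ∀ b, m (F (-b)) = - m (F b) := by
    intro b
    rw [← hm.neg (hF b)]
    congr 1
    funext g
    exact hFneg _ _
  let μ : EL G →+ ℝ := AddMonoidHom.mk' (fun b => m (F b)) hmadd
  have hBB : BB H ≤ LinearMap.ker μ.toIntLinearMap := by
    apply Submodule.span_le.2
    rintro _ (⟨g, hg, y, rfl⟩ | ⟨s, rfl⟩)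
    · change μ (y - la g y) = 0
      rw [map_sub, sub_eq_zero]
      change m (F y) = m (F (la g y))
      rw [← hm.inv g hg (F y) (hF y)]
      congr 1
      funext x
      simp only [F, la_la]
    · change m (F _) = 0
      apply hm.const
      intro g _
      simp only [F]
      have e : KK p (S (s • (1 : EL G))) = 0 := by
        rw [map_smul, hr, map_smul, map_smul, KK_one, smul_zero, smul_zero]
      rw [AlgHom.commutes, Algebra.algebraMap_eq_smul_one, e, map_zero]
  have h0 : m (F (bd G z)) = 0 := hBB hbz
  have h1 : m (F (bd G z)) = -((n + 1 + 1).factorial : ℝ) := by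
    apply hm.const
    intro g hg
    have e1 := PP_deg hp _ _ (act_mem_deg (fun x => g * x) hz)
    rw [hact, smul_zero, hS, TT_apply, ← hSb, bd_act] at e1
    have e2 := congrArg φ e1
    rw [map_add, map_add, map_zero, hφE _ (bd_mem_EE H _), zero_add, map_zsmul, hφla g hg, hφz] at e2
    have e3 : F (bd G z) g = φ (KK p (S (la g (bd G z)))) := rfl
    rw [e3]
    simp only [zsmul_eq_mul, mul_one, Int.cast_natCast] at e2
    linarith
  have h2 : (0 : ℝ) < ((n + 1 + 1).factorial : ℝ) := by positivity
  linarith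

end LowerPart

section PCPart

lemma zpow_split {k : ℤ} (hk : k ≠ 0) (j : ℤ) : ∃ q : ℤ, ∃ r ∈ Set.Icc 0 |k|,
    j = k * q + r :=
  ⟨j / k, j % k, ⟨Int.emod_nonneg _ hk, (Int.emod_lt_abs _ hk).le⟩, (Int.mul_ediv_add_emod j k).symm⟩

variable {G : Type*} [Group G]

/-- Polycyclic subgroups together with their Hirsch number. -/
inductive PC : Subgroup G → ℕ → Prop
  | bot : PC ⊥ 0
  | fin (N : Subgroup G) (h : ℕ) (g : G) (hN : PC N h) (hg : Nrm N g) (k : ℤ) (hk : k ≠ 0)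
      (hgk : g ^ k ∈ N) : PC (N ⊔ Subgroup.zpowers g) h
  | inf (N : Subgroup G) (h : ℕ) (g : G) (hN : PC N h) (hg : Nrm N g)
      (hgk : ∀ k : ℤ, k ≠ 0 → g ^ k ∉ N) : PC (N ⊔ Subgroup.zpowers g) (h + 1)

lemma PC.fg {H : Subgroup G} {h : ℕ} (hH : PC H h) : H.FG := by
  have hz : ∀ g : G, (Subgroup.zpowers g).FG := fun g =>
    ⟨{g}, by rw [Finset.coe_singleton, Subgroup.zpowers_eq_closure]⟩
  induction hH with
  | bot => exact ⟨∅, by simp⟩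
  | fin N h g _ _ _ _ _ ih => exact ih.sup (hz g)
  | inf N h g _ _ _ ih => exact ih.sup (hz g)

lemma PC.map {G' : Type*} [Group G'] (f : G →* G') (hf : Function.Injective f) {H : Subgroup G}
    {h : ℕ} (hH : PC H h) : PC (H.map f) h := by
  have hn : ∀ (N : Subgroup G) g, Nrm N g → Nrm (N.map f) (f g) := by
    intro N g hg
    constructor
    · rintro _ ⟨n, hn, rfl⟩
      exact ⟨_, hg.1 n hn, by simp⟩
    · rintro _ ⟨n, hn, rfl⟩
      exact ⟨_, hg.2 n hn, by simp⟩
  induction hH with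
  | bot => rw [Subgroup.map_bot]; exact .bot
  | fin N h g _ hg k hk hgk ih =>
    rw [Subgroup.map_sup, MonoidHom.map_zpowers]
    exact .fin _ _ _ ih (hn _ _ hg) k hk ⟨_, hgk, by simp⟩
  | inf N h g _ hg hgk ih =>
    rw [Subgroup.map_sup, MonoidHom.map_zpowers]
    refine .inf _ _ _ ih (hn _ _ hg) ?_
    rintro k hk ⟨x, hx, hxg⟩
    rw [← map_zpow] at hxg
    exact hgk k hk (hf hxg ▸ hx)

lemma SA_bot [MetricSpace G] : SA ((⊥ : Subgroup G) : Set G) 0 := by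
  intro d hd
  refine ⟨1, one_pos, fun _ => {1}, fun i x y hxy => ?_, ?_⟩
  · have : ∀ z, Relation.ReflTransGen (ChainStep d {1}) x z → z = x := by
      intro z h
      induction h with
      | refl => rfl
      | tail _ h ih =>
        rw [← ih, h.1, h.2.1]
    rw [this y hxy, dist_self]
    exact zero_le_one
  · intro x hx
    simpa using hx

theorem PC.SA [MetricSpace G] (hinv : ∀ g x y : G, dist (g * x) (g * y) = dist x y)
    (hproper : ∀ (x : G) (r : ℝ), {y : G | dist x y ≤ r}.Finite) {H : Subgroup G} {h : ℕ}
    (hH : PC H h) : SA (H : Set G) h := by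
  induction hH with
  | bot => exact SA_bot
  | fin N h g _ hg k hk hgk ih =>
    refine ih.finite_step hinv ((fun r : ℤ => g ^ r) '' Set.Icc 0 |k|)
      ((Set.finite_Icc _ _).image _) ?_
    intro x hx
    obtain ⟨n, hn, j, rfl⟩ := hg.mem_sup.1 hx
    obtain ⟨q, r, hr, rfl⟩ := zpow_split hk j
    refine ⟨n * (g ^ k) ^ q, N.mul_mem hn (N.zpow_mem hgk _), _, ⟨r, hr, rfl⟩, ?_⟩
    rw [zpow_add, zpow_mul, mul_assoc]
  | inf N h g _ hg hgk ih => exact ih.infinite_step hinv hproper hg hgk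

/-- Finite index subgroups. -/
def FI (K H : Subgroup G) : Prop :=
  K ≤ H ∧ ∃ F : Set G, F.Finite ∧ ∀ x ∈ H, ∃ f ∈ F, ∃ a ∈ K, x = f * a

lemma FI.quot {K H : Subgroup G} (h : FI K H) : Finite (H ⧸ K.subgroupOf H) := by
  obtain ⟨hK, F, hF, h⟩ := h
  have : Finite {f : H // (f : G) ∈ F} := by
    have := hF.to_subtype
    refine Finite.of_injective (fun f : {f : H // (f : G) ∈ F} => (⟨f.1.1, f.2⟩ : F)) ?_
    intro a b hab
    exact Subtype.ext (Subtype.ext (congrArg (fun f : F => (f : G)) hab))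
  refine Finite.of_surjective (fun f : {f : H // (f : G) ∈ F} =>
    (QuotientGroup.mk f.1 : H ⧸ K.subgroupOf H)) ?_
  intro x
  induction x using QuotientGroup.induction_on with
  | H x =>
    obtain ⟨f, hf, a, ha, hx⟩ := h x x.2
    have hfH : f ∈ H := by
      have : f = x * a⁻¹ := by rw [hx]; simp
      rw [this]
      exact H.mul_mem x.2 (H.inv_mem (hK ha))
    refine ⟨⟨⟨f, hfH⟩, hf⟩, ?_⟩
    rw [QuotientGroup.eq, Subgroup.mem_subgroupOf]
    simp only [Subgroup.coe_mul, Subgroup.coe_inv, hx, inv_mul_cancel_left]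
    exact ha

lemma exists_pow_nrm {K N : Subgroup G} (hfg : N.FG) (hK : FI K N) {g : G} (hg : Nrm N g) :
    ∃ m : ℕ, 0 < m ∧ Nrm K (g ^ m) := by
  have hfin := hK.quot
  have : Group.FG N := (Group.fg_iff_subgroup_fg N).2 hfg
  obtain ⟨S, hS⟩ := Group.fg_def.1 this
  let Q := N ⧸ K.subgroupOf N
  let c : ℕ → N →* N := fun k => MonoidHom.mk' (fun x => ⟨g ^ k * x * (g ^ k)⁻¹, (hg.pow k).1 x x.2⟩)
    (by intro a b; ext; simp [mul_assoc])
  let ρ : ℕ → N →* Equiv.Perm Q := fun k => (MulAction.toPermHom N Q).comp (c k)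
  obtain ⟨k, l, hkl, he⟩ := Finite.exists_ne_map_eq_of_infinite (fun k : ℕ => fun s : S => ρ k s)
  have he' : ρ k = ρ l := by
    refine MonoidHom.eq_of_eqOn_dense hS ?_
    intro x hx
    exact congrFun he ⟨x, hx⟩
  have key : ∀ k (x : N), g ^ k * x * (g ^ k)⁻¹ ∈ K ↔
      ρ k x (QuotientGroup.mk (1 : N)) = QuotientGroup.mk (1 : N) := by
    intro k x
    change _ ↔ (QuotientGroup.mk ((c k x) * 1 : N) : Q) = QuotientGroup.mk (1 : N)
    rw [eq_comm, QuotientGroup.eq, Subgroup.mem_subgroupOf]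
    simp [c]
  have key2 : ∀ x ∈ N, (g ^ k * x * (g ^ k)⁻¹ ∈ K ↔ g ^ l * x * (g ^ l)⁻¹ ∈ K) := by
    intro x hx
    rw [key k ⟨x, hx⟩, key l ⟨x, hx⟩, he']
  have main : ∀ k l, k < l → (∀ x ∈ N, (g ^ k * x * (g ^ k)⁻¹ ∈ K ↔ g ^ l * x * (g ^ l)⁻¹ ∈ K)) →
      ∃ m : ℕ, 0 < m ∧ Nrm K (g ^ m) := by
    clear key2 key he' he hkl
    intro k l hkl key2
    obtain ⟨m, rfl⟩ := Nat.exists_eq_add_of_lt hkl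
    refine ⟨m + 1, Nat.succ_pos _, fun y hy => ?_, fun y hy => ?_⟩
    · have := (key2 _ ((hg.pow k).2 y (hK.1 hy))).1 (by simpa [mul_assoc] using hy)
      have e : g ^ (k + m + 1) = g ^ (m + 1) * g ^ k := by rw [← pow_add]; congr 1; omega
      rw [e] at this
      simpa [mul_assoc] using this
    · have := (key2 _ ((hg.pow (k + m + 1)).2 y (hK.1 hy))).2 (by simpa [mul_assoc] using hy)
      have e : g ^ (k + m + 1) = g ^ (m + 1) * g ^ k := by rw [← pow_add]; congr 1; omega
      rw [e] at this
      simpa only [mul_assoc, mul_inv_rev, mul_inv_cancel_left, mul_inv_cancel, mul_one] using this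
  rcases lt_or_gt_of_ne hkl with h | h
  · exact main k l h key2
  · exact main l k h fun x hx => (key2 x hx).symm

theorem PC.PD {H : Subgroup G} {h : ℕ} (hH : PC H h) :
    ∃ K : Subgroup G, FI K H ∧ PD K h ∧ ∃ m, IsMean K m := by
  induction hH with
  | bot => exact ⟨⊥, ⟨le_rfl, {1}, Set.finite_singleton _, fun x hx => ⟨1, rfl, x, hx, by simp⟩⟩,
      PD_bot, _, isMean_bot⟩
  | fin N h g _ hg k hk hgk ih =>
    obtain ⟨K, ⟨hK, F, hF, hKF⟩, hP, hm⟩ := ih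
    refine ⟨K, ⟨hK.trans le_sup_left, Set.image2 (fun r f => g ^ r * f) (Set.Icc 0 |k|) F,
      (Set.finite_Icc _ _).image2 _ hF, ?_⟩, hP, hm⟩
    intro x hx
    obtain ⟨n, hn, j, hj⟩ := hg.mem_sup.1 (Subgroup.inv_mem _ hx)
    obtain ⟨q, r, hr, hjq⟩ := zpow_split hk (-j)
    have e : x = g ^ r * ((g ^ k) ^ q * n⁻¹) := by
      rw [← inv_inv x, hj, mul_inv_rev, ← zpow_neg, hjq, add_comm, zpow_add, zpow_mul, mul_assoc]
    obtain ⟨f, hf, a, ha, h'⟩ := hKF _ (N.mul_mem (N.zpow_mem hgk q) (N.inv_mem hn))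
    refine ⟨_, ⟨r, hr, f, hf, rfl⟩, a, ha, ?_⟩
    rw [e, h', mul_assoc]
  | inf N h g hN hg hgk ih =>
    obtain ⟨K, hFI, hP, m, hm⟩ := ih
    obtain ⟨j, hj, hn⟩ := exists_pow_nrm hN.fg hFI hg
    obtain ⟨hK, F, hF, hKF⟩ := hFI
    have hf : ∀ k : ℤ, k ≠ 0 → (g ^ j) ^ k ∉ K := by
      intro k hk h'
      rw [← zpow_natCast, ← zpow_mul] at h'
      exact hgk _ (mul_ne_zero (by exact_mod_cast hj.ne') hk) (hK h')
    refine ⟨K ⊔ Subgroup.zpowers ((g ^ j) ^ 2), ⟨?_, Set.image2 (fun r f => g ^ r * f)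
      (Set.Icc 0 |(j * 2 : ℤ)|) F, (Set.finite_Icc _ _).image2 _ hF, ?_⟩, PD_step hn hf hP,
      hm.step (hn.pow 2)⟩
    · refine sup_le (hK.trans le_sup_left) ?_
      rw [Subgroup.zpowers_le]
      exact Subgroup.pow_mem _ (Subgroup.pow_mem _
        (Subgroup.mem_sup_right (Subgroup.mem_zpowers g)) _) _
    · intro x hx
      obtain ⟨n, hn', i, rfl⟩ := hg.mem_sup.1 hx
      obtain ⟨q, r, hr, rfl⟩ := zpow_split (k := (j * 2 : ℤ))
        (mul_ne_zero (by exact_mod_cast hj.ne') two_ne_zero) i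
      have e : (g ^ r)⁻¹ * n * g ^ r ∈ N := (hg.zpow r).2 n hn'
      obtain ⟨f, hf', a, ha, h'⟩ := hKF _ e
      refine ⟨_, ⟨r, hr, f, hf', rfl⟩, a * ((g ^ j) ^ 2) ^ q, Subgroup.mul_mem _
        (Subgroup.mem_sup_left ha) (Subgroup.mem_sup_right (Subgroup.zpow_mem_zpowers _ _)), ?_⟩
      have e2 : ((g ^ j) ^ 2) ^ q = g ^ ((j * 2 : ℤ) * q) := by
        rw [zpow_mul, zpow_mul]; norm_cast
      have e3 : n * g ^ r = g ^ r * (f * a) := by rw [← h']; group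
      rw [e2, add_comm, zpow_add, ← mul_assoc, e3]
      simp only [mul_assoc]

end PCPart

section AlgPart

variable {P : Type*} [Group P]

lemma fg_step (N M : Subgroup P) (hn : (N.subgroupOf M).Normal)
    (hc : ∃ g ∈ M, ∀ x ∈ M, ∃ k : ℤ, x * (g ^ k)⁻¹ ∈ N)
    (hN : ∀ H ≤ N, H.FG) (H : Subgroup P) (hH : H ≤ M) : H.FG := by
  obtain ⟨g, hg, hgx⟩ := hc
  let q : M →* M ⧸ N.subgroupOf M := QuotientGroup.mk' _
  have hker : ∀ x : M, q x = 1 ↔ (x : P) ∈ N := by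
    intro x
    rw [← Subgroup.mem_subgroupOf]
    exact QuotientGroup.eq_one_iff x
  have hcyc : IsCyclic (M ⧸ N.subgroupOf M) := by
    refine ⟨⟨q ⟨g, hg⟩, fun x => ?_⟩⟩
    obtain ⟨x, rfl⟩ := QuotientGroup.mk'_surjective _ x
    obtain ⟨k, hk⟩ := hgx x x.2
    refine ⟨k, ?_⟩
    have : q (x * (⟨g, hg⟩ ^ k)⁻¹) = 1 := by
      rw [hker]; simpa using hk
    rw [map_mul, map_inv, map_zpow, mul_inv_eq_one] at this
    exact this.symm
  obtain ⟨y, hy⟩ := (Subgroup.isCyclic_iff_exists_zpowers_eq_top ((H.subgroupOf M).map q)).1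
    inferInstance
  have hymem : y ∈ (H.subgroupOf M).map q := by rw [← hy]; exact Subgroup.mem_zpowers y
  obtain ⟨x, hx, rfl⟩ := hymem
  have hxH : (x : P) ∈ H := hx
  have e : H = (H ⊓ N) ⊔ Subgroup.zpowers (x : P) := by
    apply le_antisymm
    · intro z hz
      have h1 : q ⟨z, hH hz⟩ ∈ (H.subgroupOf M).map q := ⟨⟨z, hH hz⟩, hz, rfl⟩
      rw [← hy] at h1
      obtain ⟨k, hk⟩ := h1
      have h2 : q (⟨z, hH hz⟩ * (x ^ k)⁻¹) = 1 := by
        rw [map_mul, map_inv, map_zpow, mul_inv_eq_one]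
        exact hk.symm
      rw [hker] at h2
      have h3 : z * ((x : P) ^ k)⁻¹ ∈ N := by simpa using h2
      have h4 : z = (z * ((x : P) ^ k)⁻¹) * (x : P) ^ k := by simp
      rw [h4]
      exact Subgroup.mul_mem _ (Subgroup.mem_sup_left
        ⟨H.mul_mem hz (H.inv_mem (H.zpow_mem hxH k)), h3⟩)
        (Subgroup.mem_sup_right (Subgroup.zpow_mem_zpowers _ _))
    · refine sup_le inf_le_left ?_
      rw [Subgroup.zpowers_le]
      exact hxH
  rw [e]
  exact (hN _ inf_le_right).sup ⟨{(x : P)}, by rw [Finset.coe_singleton, Subgroup.zpowers_eq_closure]⟩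

lemma IsPolycyclic.fg (h : IsPolycyclic P) (H : Subgroup P) : H.FG := by
  obtain ⟨n, s, h0, h1, hs⟩ := h
  have key : ∀ i : Fin (n + 1), ∀ H ≤ s i, H.FG := by
    intro i
    induction i using Fin.induction with
    | zero =>
      intro H hH
      rw [h0, le_bot_iff] at hH
      rw [hH]
      exact ⟨∅, by simp⟩
    | succ i ih =>
      intro H hH
      exact fg_step _ _ (hs i).2.1 (hs i).2.2 ih H hH
  exact key (Fin.last n) H (by rw [h1]; exact le_top)

lemma nrm_of_commutator {D K : Subgroup P} (hDK : ⁅D, D⁆ ≤ K) (hK : K ≤ D) {g : P} (hg : g ∈ D) :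
    Nrm K g := by
  have key : ∀ g ∈ D, ∀ n ∈ K, g * n * g⁻¹ ∈ K := by
    intro g hg n hn
    have h1 : g * n * g⁻¹ * n⁻¹ ∈ K := hDK (Subgroup.commutator_mem_commutator hg (hK hn))
    simpa using K.mul_mem h1 hn
  exact ⟨key g hg, fun n hn => by simpa using key g⁻¹ (D.inv_mem hg) n hn⟩

lemma span_closure {D : Subgroup P} {V : Type*} [AddCommGroup V] [Module ℚ V]
    (p : Additive D →+ V) (S : Set D) (x : D) (hx : x ∈ Subgroup.closure S) :
    p (Additive.ofMul x) ∈ Submodule.span ℚ ((fun d => p (Additive.ofMul d)) '' S) := by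
  induction hx using Subgroup.closure_induction with
  | mem x h => exact Submodule.subset_span ⟨x, h, rfl⟩
  | one => rw [ofMul_one, map_zero]; exact Submodule.zero_mem _
  | mul x y _ _ h h' => rw [ofMul_mul, map_add]; exact Submodule.add_mem _ h h'
  | inv x _ h => rw [ofMul_inv, map_neg]; exact Submodule.neg_mem _ h

lemma span_lattice {D : Subgroup P} {V : Type*} [AddCommGroup V] [Module ℚ V]
    (p : Additive D →+ V) (S : Set D) (v : V)
    (hv : v ∈ Submodule.span ℚ ((fun d => p (Additive.ofMul d)) '' S)) :
    ∃ k : ℤ, k ≠ 0 ∧ ∃ c ∈ Subgroup.closure S, k • v = p (Additive.ofMul c) := by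
  induction hv using Submodule.span_induction with
  | mem v h =>
    obtain ⟨d, hd, rfl⟩ := h
    exact ⟨1, one_ne_zero, d, Subgroup.subset_closure hd, by rw [one_smul]⟩
  | zero => exact ⟨1, one_ne_zero, 1, Subgroup.one_mem _, by rw [smul_zero, ofMul_one, map_zero]⟩
  | add v w _ _ h h' =>
    obtain ⟨k, hk, c, hc, h⟩ := h
    obtain ⟨k', hk', c', hc', h'⟩ := h'
    refine ⟨k * k', mul_ne_zero hk hk', c ^ k' * c' ^ k, Subgroup.mul_mem _
      (Subgroup.zpow_mem _ hc _) (Subgroup.zpow_mem _ hc' _), ?_⟩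
    rw [ofMul_mul, map_add, ofMul_zpow, ofMul_zpow, map_zsmul, map_zsmul, ← h, ← h', smul_add,
      ← mul_smul, ← mul_smul, mul_comm k' k]
  | smul q v _ h =>
    obtain ⟨k, hk, c, hc, h⟩ := h
    refine ⟨k * q.den, mul_ne_zero hk (by exact_mod_cast q.den_ne_zero), c ^ q.num,
      Subgroup.zpow_mem _ hc _, ?_⟩
    rw [ofMul_zpow, map_zsmul, ← h, ← mul_smul, ← Int.cast_smul_eq_zsmul ℚ,
      ← Int.cast_smul_eq_zsmul ℚ, ← mul_smul]
    congr 1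
    push_cast
    have := Rat.mul_den_eq_num q
    rw [← this]
    ring

lemma PC_span {D : Subgroup P} {V : Type*} [AddCommGroup V] [Module ℚ V]
    [Module.Finite ℚ V] (p : Additive D →+ V)
    (hp : ∀ d : D, p (Additive.ofMul d) = 0 ↔ ∃ m : ℤ, m ≠ 0 ∧ ((d : P) ^ m) ∈ ⁅D, D⁆)
    {h : ℕ} (hD : PC ⁅D, D⁆ h) (S : Finset D) :
    PC (⁅D, D⁆ ⊔ (Subgroup.closure (S : Set D)).map D.subtype)
      (h + Module.finrank ℚ (Submodule.span ℚ ((fun d => p (Additive.ofMul d)) '' (S : Set D)))) := by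
  classical
  induction S using Finset.induction_on with
  | empty =>
    rw [Finset.coe_empty, Set.image_empty, Submodule.span_empty, finrank_bot, Subgroup.closure_empty,
      Subgroup.map_bot, sup_bot_eq, add_zero]
    exact hD
  | insert g S _ ih =>
    set K := ⁅D, D⁆ ⊔ (Subgroup.closure (S : Set D)).map D.subtype with hK
    set W := Submodule.span ℚ ((fun d => p (Additive.ofMul d)) '' (S : Set D)) with hW
    have hDD : ⁅D, D⁆ ≤ D := Subgroup.commutator_le.2 fun a ha b hb =>
      D.mul_mem (D.mul_mem (D.mul_mem ha hb) (D.inv_mem ha)) (D.inv_mem hb)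
    have hKD : K ≤ D := sup_le hDD (Subgroup.map_subtype_le _)
    have hnrm : Nrm K (g : P) := nrm_of_commutator le_sup_left hKD g.2
    have hKW : ∀ x : D, (x : P) ∈ K → p (Additive.ofMul x) ∈ W := by
      let T : Subgroup D :=
        { carrier := {x | p (Additive.ofMul x) ∈ W}
          one_mem' := by
            change p (Additive.ofMul 1) ∈ W
            rw [ofMul_one, map_zero]; exact W.zero_mem
          mul_mem' := by
            intro a b ha hb
            change p (Additive.ofMul (a * b)) ∈ W
            rw [ofMul_mul, map_add]; exact W.add_mem ha hb
          inv_mem' := by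
            intro a ha
            change p (Additive.ofMul a⁻¹) ∈ W
            rw [ofMul_inv, map_neg]; exact W.neg_mem ha }
      have hT : K ≤ T.map D.subtype := by
        refine sup_le (fun x hx => ?_) (Subgroup.map_mono ?_)
        · refine ⟨⟨x, hDD hx⟩, ?_, rfl⟩
          change p _ ∈ W
          rw [(hp ⟨x, hDD hx⟩).2 ⟨1, one_ne_zero, by simpa using hx⟩]
          exact W.zero_mem
        · intro x hx
          exact span_closure p _ x hx
      intro x hx
      obtain ⟨y, hy, hyx⟩ := hT hx
      have : y = x := Subtype.ext hyx
      rw [← this]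
      exact hy
    have e : ⁅D, D⁆ ⊔ (Subgroup.closure ((insert g S : Finset D) : Set D)).map D.subtype =
        K ⊔ Subgroup.zpowers (g : P) := by
      rw [Finset.coe_insert, Set.insert_eq, Subgroup.closure_union, Subgroup.map_sup,
        ← Subgroup.zpowers_eq_closure, MonoidHom.map_zpowers, hK, sup_assoc, sup_comm (Subgroup.zpowers _)]
      rfl
    have eW : Submodule.span ℚ ((fun d => p (Additive.ofMul d)) '' ((insert g S : Finset D) : Set D))
        = W ⊔ Submodule.span ℚ {p (Additive.ofMul g)} := by
      rw [Finset.coe_insert, Set.image_insert_eq, Submodule.span_insert, sup_comm]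
    rw [e, eW]
    by_cases hgW : p (Additive.ofMul g) ∈ W
    · have : W ⊔ Submodule.span ℚ {p (Additive.ofMul g)} = W :=
        sup_eq_left.2 ((Submodule.span_singleton_le_iff_mem _ _).2 hgW)
      rw [this]
      obtain ⟨k, hk, c, hc, hkc⟩ := span_lattice p _ _ hgW
      have h0 : p (Additive.ofMul (g ^ k * c⁻¹)) = 0 := by
        rw [ofMul_mul, map_add, ofMul_zpow, map_zsmul, hkc, ofMul_inv, map_neg, add_neg_cancel]
      obtain ⟨m, hm, hm'⟩ := (hp _).1 h0
      refine .fin K _ _ ih hnrm (k * m) (mul_ne_zero hk hm) ?_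
      have hcK : (c : P) ∈ K := Subgroup.mem_sup_right ⟨c, hc, rfl⟩
      have hn : (K.subgroupOf D).Normal := ⟨fun n hn d => by
        rw [Subgroup.mem_subgroupOf] at hn ⊢
        exact (nrm_of_commutator le_sup_left hKD d.2).1 _ hn⟩
      let q : D →* D ⧸ K.subgroupOf D := QuotientGroup.mk' _
      have hq : ∀ x : D, q x = 1 ↔ (x : P) ∈ K := by
        intro x
        rw [← Subgroup.mem_subgroupOf]
        exact QuotientGroup.eq_one_iff x
      have h1 : q ((g ^ k * c⁻¹) ^ m) = 1 := (hq _).2 (by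
        have : ((g : P) ^ k * (c : P)⁻¹) ^ m ∈ K := Subgroup.mem_sup_left (by simpa using hm')
        simpa using this)
      rw [map_zpow, map_mul, map_inv, (hq c).2 hcK, inv_one, mul_one, ← map_zpow, ← zpow_mul, hq] at h1
      simpa using h1
    · have : Module.finrank ℚ (W ⊔ Submodule.span ℚ {p (Additive.ofMul g)} : Submodule ℚ V) =
          Module.finrank ℚ W + 1 := Submodule.finrank_sup_span_singleton hgW
      rw [this, ← add_assoc]
      refine .inf K _ _ ih hnrm ?_
      intro k hk hgk
      apply hgW
      have := hKW (g ^ k) (by simpa using hgk)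
      rw [ofMul_zpow, map_zsmul, ← Int.cast_smul_eq_zsmul ℚ] at this
      exact (Submodule.smul_mem_iff _ (by exact_mod_cast hk)).1 this

end AlgPart

section FinalPart

variable {P : Type*} [Group P]

/-- The rationalized abelianization map. -/
noncomputable def ratAb (D : Subgroup P) : Additive D →+ ℚ ⊗[ℤ] Additive (Abelianization D) :=
  (TensorProduct.mk ℤ ℚ (Additive (Abelianization D)) 1).toAddMonoidHom.comp
    (MonoidHom.toAdditive (Abelianization.of (G := D)))

lemma ratAb_apply (D : Subgroup P) (d : D) :
    ratAb D (Additive.ofMul d) = (1 : ℚ) ⊗ₜ[ℤ] Additive.ofMul (Abelianization.of d) := rfl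

lemma ratAb_eq_zero (D : Subgroup P) (d : D) : ratAb D (Additive.ofMul d) = 0 ↔
    ∃ m : ℤ, m ≠ 0 ∧ ((d : P) ^ m) ∈ ⁅D, D⁆ := by
  have hloc : IsLocalizedModule (nonZeroDivisors ℤ)
      (TensorProduct.mk ℤ ℚ (Additive (Abelianization D)) 1) :=
    (isLocalizedModule_iff_isBaseChange (nonZeroDivisors ℤ) ℚ _).2
      (TensorProduct.isBaseChange ℤ (Additive (Abelianization D)) ℚ)
  have h1 : ∀ m : ℤ, m • Additive.ofMul (Abelianization.of d) = 0 ↔ ((d : P) ^ m) ∈ ⁅D, D⁆ := by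
    intro m
    rw [← ofMul_zpow, ← map_zpow, ofMul_eq_zero, ← MonoidHom.mem_ker, Abelianization.ker_of,
      ← Subgroup.map_subtype_commutator]
    constructor
    · intro h; exact ⟨_, h, by simp⟩
    · rintro ⟨y, hy, h⟩
      have : y = d ^ m := Subtype.ext (by simpa using h)
      rw [← this]; exact hy
  rw [ratAb_apply]
  have h2 := IsLocalizedModule.eq_zero_iff (nonZeroDivisors ℤ)
    (TensorProduct.mk ℤ ℚ (Additive (Abelianization D)) 1) (m := Additive.ofMul (Abelianization.of d))
  rw [TensorProduct.mk_apply] at h2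
  rw [h2]
  constructor
  · rintro ⟨c, hc⟩
    exact ⟨c, nonZeroDivisors.ne_zero c.2, (h1 _).1 hc⟩
  · rintro ⟨m, hm, h⟩
    exact ⟨⟨m, mem_nonZeroDivisors_of_ne_zero hm⟩, (h1 m).2 h⟩

lemma ratAb_span (D : Subgroup P) (S : Set D) (hS : Subgroup.closure S = ⊤) :
    Submodule.span ℚ ((fun d => ratAb D (Additive.ofMul d)) '' S) = ⊤ := by
  rw [eq_top_iff]
  rintro v -
  induction v using TensorProduct.induction_on with
  | zero => exact Submodule.zero_mem _
  | add x y hx hy => exact Submodule.add_mem _ hx hy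
  | tmul q a =>
    obtain ⟨d, hd⟩ := QuotientGroup.mk_surjective (Additive.toMul a)
    have : q ⊗ₜ[ℤ] a = q • ratAb D (Additive.ofMul d) := by
      rw [ratAb_apply, TensorProduct.smul_tmul', smul_eq_mul, mul_one]
      congr 1
      exact hd.symm
    rw [this]
    exact Submodule.smul_mem _ _ (span_closure _ S d (by rw [hS]; trivial))

lemma PC_abel (D : Subgroup P) (hfg : D.FG) {h : ℕ} (hD : PC ⁅D, D⁆ h) :
    Module.Finite ℚ (ℚ ⊗[ℤ] Additive (Abelianization D)) ∧
    PC D (h + Module.finrank ℚ (ℚ ⊗[ℤ] Additive (Abelianization D))) := by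
  have : Group.FG D := (Group.fg_iff_subgroup_fg D).2 hfg
  obtain ⟨S, hS⟩ := Group.fg_def.1 this
  have hsp := ratAb_span D _ hS
  have hfin : Module.Finite ℚ (ℚ ⊗[ℤ] Additive (Abelianization D)) := by
    refine ⟨?_⟩
    rw [← hsp]
    exact Submodule.fg_span (S.finite_toSet.image _)
  refine ⟨hfin, ?_⟩
  have := PC_span (ratAb D) (ratAb_eq_zero D) hD S
  rw [hsp, hS, finrank_top, ← MonoidHom.range_eq_map, Subgroup.range_subtype] at this
  have hDD : ⁅D, D⁆ ≤ D := Subgroup.commutator_le.2 fun a ha b hb =>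
      D.mul_mem (D.mul_mem (D.mul_mem ha hb) (D.inv_mem ha)) (D.inv_mem hb)
  rwa [sup_eq_right.2 hDD] at this

lemma PC_derived (hP : IsPolycyclic P) (n : ℕ) (hn : derivedSeries P n = ⊥) :
    ∃ h : ℕ, PC (⊤ : Subgroup P) h ∧ ∑ i ∈ Finset.range n,
      qdim (ℚ ⊗[ℤ] Additive (Abelianization (derivedSeries P i))) = (h : ℕ∞) := by
  have key : ∀ j ≤ n, ∃ h : ℕ, PC (derivedSeries P (n - j)) h ∧ ∑ i ∈ Finset.Ico (n - j) n,
      qdim (ℚ ⊗[ℤ] Additive (Abelianization (derivedSeries P i))) = (h : ℕ∞) := by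
    intro j
    induction j with
    | zero =>
      intro _
      refine ⟨0, ?_, by simp⟩
      rw [Nat.sub_zero, hn]
      exact .bot
    | succ j ih =>
      intro hj
      obtain ⟨h, h1, h2⟩ := ih (by omega)
      obtain ⟨i, hi⟩ : ∃ i, i = n - (j + 1) := ⟨_, rfl⟩
      have hi' : n - j = i + 1 := by omega
      rw [← hi]
      rw [hi'] at h1 h2
      rw [derivedSeries_succ] at h1
      obtain ⟨h3, h4⟩ := PC_abel (derivedSeries P i) (hP.fg _) h1
      refine ⟨_, h4, ?_⟩
      rw [Finset.sum_eq_sum_Ico_succ_bot (by omega), h2, qdim, if_pos h3]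
      push_cast
      rw [add_comm]
  obtain ⟨h, h1, h2⟩ := key n le_rfl
  rw [Nat.sub_self] at h1 h2
  rw [derivedSeries_zero] at h1
  refine ⟨h, h1, ?_⟩
  rw [← h2, Finset.range_eq_Ico]

end FinalPart

/-- Let `Γ` be a virtually polycyclic group with a proper left invariant
metric, witnessed by a polycyclic normal subgroup `Γ'` of finite index whose derived series
terminates at `⊥` after `n` steps. Then `asdim Γ` equals the Hirsch length
`h(Γ) = h(Γ') = Σᵢ dim_ℚ ((Gᵢ₊₁/Gᵢ) ⊗_ℤ ℚ)`, where the successive quotients of the derived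
series of `Γ'` are realized as the abelianizations of its terms. -/
theorem asdim_virtually_polycyclic_eq_hirsch_length {Γ : Type*} [Group Γ] [Countable Γ]
    [MetricSpace Γ]
    (hinv : ∀ g x y : Γ, dist (g * x) (g * y) = dist x y)
    (hproper : ∀ (x : Γ) (r : ℝ), {y : Γ | dist x y ≤ r}.Finite)
    (Γ' : Subgroup Γ) [Γ'.Normal] (hindex : Γ'.FiniteIndex)
    (hpoly : IsPolycyclic Γ')
    (n : ℕ) (hn : derivedSeries Γ' n = ⊥) :
    asdim Γ = ∑ i ∈ Finset.range n,
      qdim (ℚ ⊗[ℤ] Additive (Abelianization (derivedSeries Γ' i))) := by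
  obtain ⟨h, hPC, hsum⟩ := PC_derived hpoly n hn
  rw [hsum]
  have hPC' : PC Γ' h := by
    have := hPC.map Γ'.subtype Γ'.subtype_injective
    rwa [← MonoidHom.range_eq_map, Subgroup.range_subtype] at this
  have hub : AsdimLE Γ h := by
    rw [asdimLE_iff_SA]
    have hq : Finite (Γ ⧸ Γ') := inferInstance
    refine (hPC'.SA hinv hproper).finite_step hinv
      (Set.range (fun q : Γ ⧸ Γ' => (Quotient.out q)⁻¹)) (Set.finite_range _) ?_
    intro x _
    have := QuotientGroup.mk_out_eq_mul Γ' x⁻¹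
    obtain ⟨k, hk⟩ := this
    refine ⟨k, k.2, _, ⟨(QuotientGroup.mk x⁻¹ : Γ ⧸ Γ'), rfl⟩, ?_⟩
    simp only [hk, mul_inv_rev, inv_inv, mul_inv_cancel_left]
  have hlb : ∀ m : ℕ, AsdimLE Γ m → h ≤ m := by
    intro m hm
    by_contra hlt
    obtain ⟨j, rfl⟩ : ∃ j, h = j + 1 := ⟨h - 1, by omega⟩
    obtain ⟨K, _, hPD, μ, hμ⟩ := hPC'.PD
    exact lower_bound hinv hproper hμ hPD ((asdimLE_iff_SA.1 hm).le (by omega))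
  apply le_antisymm
  · exact sInf_le ⟨h, rfl, hub⟩
  · apply le_sInf
    rintro _ ⟨m, rfl, hm⟩
    exact_mod_cast hlb m hm
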